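/- arXiv:math/0201265 — 6 statements merged into one kernel-verified Lean document; each statement's English description precedes it below -/
import Mathlib

section
/- Let f be a multiplicative arithmetic function satisfying 0 ≤ f(p^r) ≤ c₁·c₂^r for all primes p and all r ≥ 1, where c₁ ≥ 1 and 1 ≤ c₂ < 2 are constants, and suppose that ∑_{p ≤ x, p prime} f(p) = τ·Li(x) + O(x·(log x)^{-2-ρ}) for fixed real numbers τ > 0 and ρ > 1 with τ ≠ 1, and let B_f and C₁(f) be the associated constants with ∑_{n ≤ x} Λ_f(n)/n = τ·log x + B_f + o(1) and ∑_{n ≤ x} f(n) ∼ C₁(f)·x/(log x)^{1-τ}. If ∑_{n ≤ x} f(n) = C₁(f)·∫_1^x dt/(log t)^{1-τ} + O(x/(log x)^r) for some r > 2 − τ, then B_f = 0. -/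
open Filter Finset Asymptotics Topology

lemma aux_exp_image : Real.exp '' (Set.Ioi 0) = Set.Ioi 1 := by
  ext x
  constructor
  · rintro ⟨y, hy, rfl⟩
    exact Real.one_lt_exp_iff.mpr hy
  · intro hx
    exact ⟨Real.log x, Real.log_pos hx, Real.exp_log (by linarith [Set.mem_Ioi.mp hx])⟩

lemma aux_gamma_int {a d : ℝ} (ha : 0 < a) (hd : 0 < d) :
    MeasureTheory.IntegrableOn (fun x : ℝ => Real.log x ^ (a - 1) * x ^ (-(1 + d))) (Set.Ioi 1) ∧
    ∫ x in Set.Ioi (1:ℝ), Real.log x ^ (a - 1) * x ^ (-(1 + d)) = d ^ (-a) * Real.Gamma a := by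
  have key := Real.integral_rpow_mul_exp_neg_mul_Ioi ha hd
  have hint : MeasureTheory.IntegrableOn (fun x : ℝ ↦ x ^ (a - 1) * Real.exp (-(d * x)))
      (Set.Ioi 0) :=
    .of_integral_ne_zero (by
      rw [key]; have := Real.Gamma_pos_of_pos ha; positivity)
  have hder : ∀ x ∈ Set.Ioi (0:ℝ), HasDerivWithinAt Real.exp (Real.exp x) (Set.Ioi 0) x :=
    fun x _ => (Real.hasDerivAt_exp x).hasDerivWithinAt
  have hinj : Set.InjOn Real.exp (Set.Ioi 0) := Real.exp_injective.injOn
  have hcongr : Set.EqOn (fun x => |Real.exp x| • (Real.log (Real.exp x) ^ (a - 1) *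
      (Real.exp x) ^ (-(1 + d)))) (fun x : ℝ ↦ x ^ (a - 1) * Real.exp (-(d * x))) (Set.Ioi 0) := by
    intro x _
    simp only [abs_of_pos (Real.exp_pos x), Real.log_exp, smul_eq_mul, ← Real.exp_mul]
    rw [mul_left_comm, ← Real.exp_add]
    congr 2
    ring
  constructor
  · rw [← aux_exp_image, MeasureTheory.integrableOn_image_iff_integrableOn_abs_deriv_smul
      measurableSet_Ioi hder hinj]
    exact hint.congr_fun hcongr.symm measurableSet_Ioi
  · rw [← aux_exp_image, MeasureTheory.integral_image_eq_integral_abs_deriv_smul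
      measurableSet_Ioi hder hinj, MeasureTheory.setIntegral_congr_fun measurableSet_Ioi hcongr,
      key, one_div, Real.inv_rpow hd.le, Real.rpow_neg hd.le]

lemma aux_dyadic {h : ℝ → ℝ} {a k : ℝ} (ha : a ≠ 0)
    (h1 : Tendsto (fun d => d ^ a * h d) (𝓝[>] 0) (𝓝 k))
    (h2 : Tendsto (fun d => d ^ a * (h d - h (2 * d))) (𝓝[>] 0) (𝓝 0)) : k = 0 := by
  have t2 : Tendsto (fun d : ℝ => 2 * d) (𝓝[>] 0) (𝓝[>] 0) := by
    refine tendsto_nhdsWithin_iff.mpr ⟨?_, ?_⟩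
    · refine tendsto_nhdsWithin_of_tendsto_nhds ?_
      have : Continuous fun d : ℝ => 2 * d := by fun_prop
      simpa using this.tendsto 0
    · filter_upwards [self_mem_nhdsWithin] with d hd
      have : 0 < d := hd
      show (0:ℝ) < 2 * d
      linarith
  have h3 := h1.comp t2
  have h4 : Tendsto (fun d => (2:ℝ)^a * (d ^ a * h d - d ^ a * (h d - h (2 * d)))) (𝓝[>] 0)
      (𝓝 ((2:ℝ)^a * (k - 0))) := (h1.sub h2).const_mul _
  have h5 : k = (2:ℝ)^a * (k - 0) := by
    refine tendsto_nhds_unique (h3.congr' ?_) h4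
    filter_upwards [self_mem_nhdsWithin] with d hd
    have : 0 < d := hd
    simp only [Function.comp]
    rw [Real.mul_rpow (by norm_num) this.le]
    ring
  have h6 : (2:ℝ)^a ≠ 1 := by
    intro h
    have h' := congrArg Real.log h
    rw [Real.log_rpow (by norm_num), Real.log_one] at h'
    rcases mul_eq_zero.mp h' with h | h
    · exact ha h
    · exact (Real.log_pos (by norm_num : (1:ℝ) < 2)).ne' h
  have h7 : ((2:ℝ)^a - 1) * k = 0 := by linarith
  rcases mul_eq_zero.mp h7 with h | h
  · exact absurd (by linarith) h6
  · exact h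

lemma aux_lip {L L' : ℝ → ℝ} {b : ℝ} (hL : ∀ x, 0 < x → HasDerivAt L (L' x) x)
    (hb : Tendsto L' (𝓝[>] 0) (𝓝 b)) :
    ∃ g : ℝ, 0 < g ∧ Tendsto (fun x => (Real.exp (L x) - g) / x) (𝓝[>] 0) (𝓝 (g * b)) := by
  have hev : ∀ᶠ x in 𝓝[>] (0:ℝ), ‖L' x‖ < ‖b‖ + 1 :=
    hb.norm.eventually_lt_const (by linarith)
  obtain ⟨u, hu, hu2⟩ := (mem_nhdsGT_iff_exists_Ioo_subset).mp hev
  have hu0 : (0:ℝ) < u := hu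
  have hlip : LipschitzOnWith (Real.toNNReal (‖b‖ + 1)) L (Set.Ioo 0 u) := by
    apply (convex_Ioo 0 u).lipschitzOnWith_of_nnnorm_deriv_le (𝕜 := ℝ)
    · intro x hx
      exact (hL x hx.1).differentiableAt
    · intro x hx
      rw [(hL x hx.1).deriv]
      have : ‖L' x‖ < ‖b‖ + 1 := hu2 hx
      rw [← NNReal.coe_le_coe, coe_nnnorm, Real.coe_toNNReal _ (by positivity)]
      exact this.le
  obtain ⟨G, hG, hGL⟩ := hlip.extend_real
  have hmem : Set.Ioo 0 u ∈ 𝓝[>] (0:ℝ) := Ioo_mem_nhdsGT hu0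
  have hGd : ∀ x ∈ Set.Ioo 0 u, HasDerivAt G (L' x) x := by
    intro x hx
    refine (hL x hx.1).congr_of_eventuallyEq ?_
    filter_upwards [isOpen_Ioo.mem_nhds hx] with y hy
    exact (hGL hy).symm
  have hd : HasDerivWithinAt G b (Set.Ici 0) 0 := by
    apply hasDerivWithinAt_Ici_of_tendsto_deriv (s := Set.Ioo 0 u)
    · intro x hx
      exact (hGd x hx).differentiableAt.differentiableWithinAt
    · exact hG.continuous.continuousWithinAt
    · exact hmem
    · refine hb.congr' ?_
      filter_upwards [hmem] with x hx
      exact (hGd x hx).deriv.symm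
  refine ⟨Real.exp (G 0), Real.exp_pos _, ?_⟩
  have he := hd.exp
  rw [hasDerivWithinAt_iff_tendsto_slope] at he
  have hs : Set.Ici (0:ℝ) \ {0} = Set.Ioi 0 := by
    ext x; simp [lt_iff_le_and_ne, eq_comm]
  rw [hs] at he
  refine he.congr' ?_
  filter_upwards [hmem] with x hx
  rw [slope_def_field, hGL hx]
  simp

lemma aux_meas_sum (c : ℕ → ℝ) : Measurable (fun t : ℝ => ∑ n ∈ Finset.Icc 1 ⌊t⌋₊, c n) :=
  (measurable_from_nat (f := fun N => ∑ n ∈ Finset.Icc 1 N, c n)).comp Nat.measurable_floor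

lemma aux_sum_bdd (c : ℕ → ℝ) (x t : ℝ) (h : t ≤ x) :
    |∑ n ∈ Finset.Icc 1 ⌊t⌋₊, c n| ≤ ∑ n ∈ Finset.Icc 1 ⌊x⌋₊, |c n| := by
  refine (Finset.abs_sum_le_sum_abs _ _).trans ?_
  apply Finset.sum_le_sum_of_subset_of_nonneg
  · exact Finset.Icc_subset_Icc le_rfl (Nat.floor_mono h)
  · intros; positivity

/-- basic integrals -/
lemma aux_int1 {d : ℝ} (hd : 0 < d) :
    MeasureTheory.IntegrableOn (fun x : ℝ => x ^ (-(1 + d))) (Set.Ioi 1) ∧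
    ∫ x in Set.Ioi (1:ℝ), x ^ (-(1 + d)) = d⁻¹ := by
  have := aux_gamma_int one_pos hd
  simpa [Real.rpow_neg_one] using this

lemma aux_int2 {d : ℝ} (hd : 0 < d) :
    MeasureTheory.IntegrableOn (fun x : ℝ => Real.log x * x ^ (-(1 + d))) (Set.Ioi 1) ∧
    ∫ x in Set.Ioi (1:ℝ), Real.log x * x ^ (-(1 + d)) = (d⁻¹) ^ 2 := by
  have := aux_gamma_int two_pos hd
  norm_num [Real.Gamma_two] at this
  have e : -(1 + d) = -d + -1 := by ring
  simpa [e] using this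

lemma aux_D (c : ℕ → ℝ) (hc : c 0 = 0) (τ B : ℝ)
    (hB : Tendsto (fun x : ℝ => (∑ n ∈ Finset.Icc 1 ⌊x⌋₊, c n) - τ * Real.log x) atTop (𝓝 B)) :
    ∃ D : ℝ → ℝ, (∀ d, 0 < d → Tendsto (fun N : ℕ => ∑ n ∈ Finset.Icc 1 N, (n:ℝ) ^ (-d) * c n)
      atTop (𝓝 (D d))) ∧ Tendsto (fun d => D d - τ / d) (𝓝[>] 0) (𝓝 B) := by
  set T : ℝ → ℝ := fun t => ∑ n ∈ Finset.Icc 1 ⌊t⌋₊, c n with hT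
  set ε : ℝ → ℝ := fun t => T t - τ * Real.log t - B with hε
  have hTm : Measurable T := aux_meas_sum c
  have hεm : Measurable ε := (hTm.sub (Real.measurable_log.const_mul τ)).sub_const B
  have hε0 : Tendsto ε atTop (𝓝 0) := by
    have := hB.sub_const B
    simpa using this
  have hbd : ∀ η, 0 < η → ∃ K, 0 ≤ K ∧ ∀ t, 1 < t → |ε t| ≤ η + K * t⁻¹ := by
    intro η hη
    have h1 : ∀ᶠ t in atTop, |ε t| < η := by
      have := hε0.abs
      rw [abs_zero] at this
      exact this.eventually_lt_const hη
    obtain ⟨x0, hx0⟩ := eventually_atTop.mp h1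
    set x := max x0 1 with hx
    have hx1 : 1 ≤ x := le_max_right _ _
    set K := (∑ n ∈ Finset.Icc 1 ⌊x⌋₊, |c n|) + |τ| * Real.log x + |B| with hK
    have hlx : 0 ≤ Real.log x := Real.log_nonneg hx1
    have hK0 : 0 ≤ K := by positivity
    refine ⟨K * x, by positivity, fun t ht => ?_⟩
    have ht0 : 0 < t := by linarith
    rcases le_total x t with h | h
    · have := hx0 t ((le_max_left _ _).trans h)
      have : 0 ≤ K * x * t⁻¹ := by positivity
      linarith
    · have h2 : |ε t| ≤ K := by
        have e1 := aux_sum_bdd c x t h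
        have e2 : |τ * Real.log t| ≤ |τ| * Real.log x := by
          rw [abs_mul, abs_of_nonneg (Real.log_nonneg ht.le)]
          gcongr
        calc |ε t| ≤ |T t| + |τ * Real.log t| + |B| := by
              refine (abs_sub _ _).trans ?_
              gcongr
              exact abs_sub _ _
          _ ≤ K := by simp only [hK, hT]; linarith
      have h3 : K * 1 ≤ K * (x * t⁻¹) := by
        gcongr
        rw [← div_eq_mul_inv, le_div_iff₀ ht0]; linarith
      linarith
  have hrp : ∀ {d t : ℝ}, 0 < d → 1 < t → t⁻¹ * t ^ (-(1 + d)) ≤ t ^ (-(1 + (1:ℝ))) := by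
    intro d t hd ht
    rw [← Real.rpow_neg_one, ← Real.rpow_add (by linarith)]
    exact Real.rpow_le_rpow_of_exponent_le ht.le (by linarith)
  have hdom : ∀ {d η K t : ℝ}, 0 ≤ K → 0 < d → 1 < t → |ε t| ≤ η + K * t⁻¹ →
      ‖ε t * t ^ (-(1 + d))‖ ≤ η * t ^ (-(1 + d)) + K * t ^ (-(1 + (1:ℝ))) := by
    intro d η K t hK hd ht h
    have ht0 : 0 < t := by linarith
    rw [norm_mul, Real.norm_eq_abs, Real.norm_eq_abs, abs_of_nonneg (Real.rpow_nonneg ht0.le _)]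
    calc |ε t| * t ^ (-(1 + d)) ≤ (η + K * t⁻¹) * t ^ (-(1 + d)) := by
          gcongr
      _ = η * t ^ (-(1 + d)) + K * (t⁻¹ * t ^ (-(1 + d))) := by ring
      _ ≤ _ := by
          have := mul_le_mul_of_nonneg_left (hrp hd ht) hK
          linarith
  have hdomint : ∀ {d : ℝ} (η K : ℝ), 0 < d → MeasureTheory.IntegrableOn
      (fun t : ℝ => η * t ^ (-(1 + d)) + K * t ^ (-(1 + (1:ℝ)))) (Set.Ioi 1) := by
    intro d η K hd
    exact ((aux_int1 hd).1.const_mul η).add ((aux_int1 one_pos).1.const_mul K)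
  have hεi : ∀ {d : ℝ}, 0 < d → MeasureTheory.IntegrableOn
      (fun t : ℝ => ε t * t ^ (-(1 + d))) (Set.Ioi 1) := by
    intro d hd
    obtain ⟨K, hK, hb⟩ := hbd 1 one_pos
    refine (hdomint 1 K hd).mono' ?_ ?_
    · exact (hεm.mul (measurable_id.pow_const _)).aestronglyMeasurable
    · filter_upwards [MeasureTheory.ae_restrict_mem measurableSet_Ioi] with t ht
      exact hdom hK hd ht (hb t ht)
  have hTeq : ∀ d : ℝ, (fun t : ℝ => T t * t ^ (-(1 + d))) = fun t =>
      ε t * t ^ (-(1 + d)) + τ * (Real.log t * t ^ (-(1 + d))) + B * t ^ (-(1 + d)) := by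
    intro d; ext t; simp only [hε]; ring
  have hTi : ∀ {d : ℝ}, 0 < d → MeasureTheory.IntegrableOn
      (fun t : ℝ => T t * t ^ (-(1 + d))) (Set.Ioi 1) := by
    intro d hd
    rw [hTeq]
    exact ((hεi hd).add ((aux_int2 hd).1.const_mul τ)).add ((aux_int1 hd).1.const_mul B)
  have hTint : ∀ {d : ℝ}, 0 < d → d * ∫ t in Set.Ioi (1:ℝ), T t * t ^ (-(1 + d)) =
      d * (∫ t in Set.Ioi (1:ℝ), ε t * t ^ (-(1 + d))) + τ / d + B := by
    intro d hd
    have hi : MeasureTheory.IntegrableOn (fun t : ℝ => ε t * t ^ (-(1 + d)) +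
        τ * (Real.log t * t ^ (-(1 + d)))) (Set.Ioi 1) :=
      (hεi hd).add ((aux_int2 hd).1.const_mul τ)
    rw [hTeq, MeasureTheory.integral_add hi ((aux_int1 hd).1.const_mul B),
      MeasureTheory.integral_add (hεi hd) ((aux_int2 hd).1.const_mul τ),
      MeasureTheory.integral_const_mul, MeasureTheory.integral_const_mul,
      (aux_int1 hd).2, (aux_int2 hd).2]
    field_simp
  refine ⟨fun d => d * ∫ t in Set.Ioi (1:ℝ), T t * t ^ (-(1 + d)), ?_, ?_⟩
  · intro d hd
    have hIcc : ∀ N : ℕ, ∑ k ∈ Finset.Icc 0 N, c k = ∑ k ∈ Finset.Icc 1 N, c k := by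
      intro N
      rw [Finset.Icc_eq_cons_Ioc (Nat.zero_le _), Finset.sum_cons, hc, zero_add]
      rfl
    have hder : ∀ t : ℝ, 0 < t → HasDerivAt (fun t : ℝ => t ^ (-d)) (-d * t ^ (-(1 + d))) t := by
      intro t ht
      have := Real.hasDerivAt_rpow_const (p := -d) (Or.inl ht.ne')
      convert this using 2
      congr 1; ring
    have hA : ∀ N : ℕ, 1 ≤ N → ∑ n ∈ Finset.Icc 1 N, (n:ℝ) ^ (-d) * c n =
        (N:ℝ) ^ (-d) * T N + d * ∫ t in (1:ℝ)..N, T t * t ^ (-(1 + d)) := by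
      intro N hN
      have h0 : ∑ n ∈ Finset.Icc 1 N, (n:ℝ) ^ (-d) * c n =
          ∑ n ∈ Finset.Icc 0 N, (n:ℝ) ^ (-d) * c n := by
        rw [Finset.Icc_eq_cons_Ioc (Nat.zero_le _), Finset.sum_cons, hc, mul_zero, zero_add]
        rfl
      have hco : ContinuousOn (fun t : ℝ => -d * t ^ (-(1 + d))) (Set.Icc 1 (N:ℝ)) := by
        intro t ht
        have : t ≠ 0 := by linarith [ht.1]
        exact ((Real.continuousAt_rpow_const _ _ (Or.inl this)).const_mul _
          |>.continuousWithinAt)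
      have hde : ∀ t ∈ Set.Icc 1 (N:ℝ), deriv (fun t : ℝ => t ^ (-d)) t = -d * t ^ (-(1 + d)) :=
        fun t ht => (hder t (by linarith [ht.1])).deriv
      have := sum_mul_eq_sub_integral_mul₀' (f := fun t : ℝ => t ^ (-d)) c hc N
        (fun t ht => (hder t (by linarith [ht.1])).differentiableAt)
        (hco.integrableOn_Icc.congr_fun (fun t ht => (hde t ht).symm) measurableSet_Icc)
      rw [h0, this, hIcc, intervalIntegral.integral_of_le (by exact_mod_cast hN),
        ← MeasureTheory.integral_const_mul, sub_eq_add_neg, ← MeasureTheory.integral_neg]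
      congr 1
      · simp [hT]
      · refine MeasureTheory.setIntegral_congr_fun measurableSet_Ioc fun t ht => ?_
        rw [hde t ⟨ht.1.le, ht.2⟩, hIcc]
        simp only [hT]; ring
    have hT1 : Tendsto (fun N : ℕ => (N:ℝ) ^ (-d) * T N) atTop (𝓝 0) := by
      have h1 : Tendsto (fun x : ℝ => x ^ (-d) * (T x - τ * Real.log x) +
          τ * (Real.log x * x ^ (-d))) atTop (𝓝 (0 * B + τ * 0)) := by
        refine ((tendsto_rpow_neg_atTop hd).mul hB).add (Tendsto.const_mul _ ?_)
        have := (isLittleO_log_rpow_atTop hd).tendsto_div_nhds_zero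
        refine this.congr' ?_
        filter_upwards [eventually_gt_atTop 0] with x hx
        rw [Real.rpow_neg hx.le, div_eq_mul_inv]
      simp only [zero_mul, mul_zero, add_zero] at h1
      have h2 := h1.comp (tendsto_natCast_atTop_atTop (R := ℝ))
      refine h2.congr fun N => ?_
      simp only [Function.comp]; ring
    have hT2 := MeasureTheory.intervalIntegral_tendsto_integral_Ioi 1 (hTi hd)
      (tendsto_natCast_atTop_atTop (R := ℝ))
    have := hT1.add (hT2.const_mul d)
    rw [zero_add] at this
    refine this.congr' ?_
    filter_upwards [eventually_ge_atTop 1] with N hN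
    exact (hA N hN).symm
  · suffices h : Tendsto (fun d => d * (∫ t in Set.Ioi (1:ℝ), ε t * t ^ (-(1 + d)))) (𝓝[>] 0)
        (𝓝 0) by
      have h' := h.add_const B
      rw [zero_add] at h'
      refine h'.congr' ?_
      filter_upwards [self_mem_nhdsWithin] with d hd
      rw [hTint hd]; ring
    rw [Metric.tendsto_nhds]
    intro η hη
    obtain ⟨K, hK, hb⟩ := hbd (η / 2) (by linarith)
    have hlim : Tendsto (fun d : ℝ => d * K) (𝓝[>] 0) (𝓝 0) := by
      refine tendsto_nhdsWithin_of_tendsto_nhds ?_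
      have : Continuous fun d : ℝ => d * K := by fun_prop
      simpa using this.tendsto 0
    filter_upwards [self_mem_nhdsWithin, hlim.eventually_lt_const (by linarith : (0:ℝ) < η / 2)]
      with d hd hdK
    have hd : 0 < d := hd
    rw [dist_zero_right, norm_mul, Real.norm_eq_abs, abs_of_pos hd]
    have h1 : ‖∫ t in Set.Ioi (1:ℝ), ε t * t ^ (-(1 + d))‖ ≤ η / 2 * d⁻¹ + K := by
      calc _ ≤ ∫ t in Set.Ioi (1:ℝ), (η / 2 * t ^ (-(1 + d)) + K * t ^ (-(1 + (1:ℝ)))) := by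
            refine MeasureTheory.norm_integral_le_of_norm_le (hdomint _ K hd) ?_
            filter_upwards [MeasureTheory.ae_restrict_mem measurableSet_Ioi] with t ht
            exact hdom hK hd ht (hb t ht)
        _ = _ := by
            rw [MeasureTheory.integral_add ((aux_int1 hd).1.const_mul _)
              ((aux_int1 one_pos).1.const_mul K), MeasureTheory.integral_const_mul,
              MeasureTheory.integral_const_mul, (aux_int1 hd).2, (aux_int1 one_pos).2]
            simp
    calc _ ≤ d * (η / 2 * d⁻¹ + K) := by gcongr
      _ = η / 2 + d * K := by field_simp
      _ < η := by linarith

lemma aux_mertens (f Λf : ℕ → ℝ) (d Dd : ℝ) (hf0 : f 0 = 0)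
    (hs : Summable fun n : ℕ => f n * (n:ℝ) ^ (-(1 + d)))
    (hs' : Summable fun n : ℕ => Real.log n * (f n * (n:ℝ) ^ (-(1 + d))))
    (hΛf : ∀ n : ℕ, 1 ≤ n → f n * Real.log n = ∑ d ∈ n.divisors, f d * Λf (n / d))
    (hD : Tendsto (fun N : ℕ => ∑ n ∈ Finset.Icc 1 N, (n:ℝ) ^ (-d) * (Λf n / n)) atTop (𝓝 Dd)) :
    ∑' n : ℕ, Real.log n * (f n * (n:ℝ) ^ (-(1 + d))) =
      (∑' n : ℕ, f n * (n:ℝ) ^ (-(1 + d))) * Dd := by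
  set a : ℕ → ℝ := fun n => f n * (n:ℝ) ^ (-(1 + d)) with ha
  set P : ℕ → ℝ := fun N => ∑ n ∈ Finset.Icc 1 N, (n:ℝ) ^ (-d) * (Λf n / n) with hP
  have ha0 : a 0 = 0 := by simp [ha, hf0]
  have hl0 : ((0:ℕ):ℝ) ^ (-d) * (Λf 0 / ((0:ℕ):ℝ)) = 0 := by simp
  let A : ArithmeticFunction ℝ := ⟨a, ha0⟩
  let Lm : ArithmeticFunction ℝ := ⟨fun n => (n:ℝ) ^ (-d) * (Λf n / n), hl0⟩
  have hconv : ∀ n : ℕ, 1 ≤ n → Real.log n * a n = (A * Lm) n := by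
    intro n hn
    rw [ArithmeticFunction.mul_apply, Nat.sum_divisorsAntidiagonal (fun i j => A i * Lm j)]
    simp only [ha]
    rw [← mul_assoc, mul_comm (Real.log n), hΛf n hn, Finset.sum_mul]
    refine Finset.sum_congr rfl fun k hk => ?_
    obtain ⟨m, rfl⟩ := Nat.dvd_of_mem_divisors hk
    have hk0 : 0 < k := Nat.pos_of_ne_zero (by rintro rfl; simp at hn)
    have hm0 : 0 < m := Nat.pos_of_ne_zero (by rintro rfl; simp at hn)
    rw [Nat.mul_div_cancel_left _ hk0]
    show f k * Λf m * ((k * m : ℕ) : ℝ) ^ (-(1 + d)) =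
      (f k * (k:ℝ) ^ (-(1 + d))) * ((m:ℝ) ^ (-d) * (Λf m / m))
    have hkr : (0:ℝ) < k := by exact_mod_cast hk0
    have hmr : (0:ℝ) < m := by exact_mod_cast hm0
    have e : (m:ℝ) ^ (-(1 + d)) = (m:ℝ) ^ (-d) * (m:ℝ)⁻¹ := by
      rw [← Real.rpow_neg_one, ← Real.rpow_add hmr]; congr 1; ring
    push_cast
    rw [Real.mul_rpow hkr.le hmr.le, e]
    field_simp
  have hsum : ∀ N : ℕ, ∑ n ∈ Finset.Icc 1 N, Real.log n * a n =
      ∑' k, a k * P (N / k) := by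
    intro N
    rw [Finset.sum_congr rfl fun n hn => hconv n (Finset.mem_Icc.mp hn).1]
    have h1 := ArithmeticFunction.sum_Ioc_mul_eq_sum_sum A Lm N
    have h2 : ∑ n ∈ Finset.Icc 1 N, (A * Lm) n = ∑ n ∈ Finset.Ioc 0 N, (A * Lm) n := rfl
    rw [h2, h1, tsum_eq_sum (s := Finset.Ioc 0 N)]
    · rfl
    · intro k hk
      rcases Nat.eq_zero_or_pos k with rfl | hk0
      · simp [ha0]
      · have : N < k := by
          by_contra h
          exact hk (Finset.mem_Ioc.mpr ⟨hk0, not_lt.mp h⟩)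
        simp [Nat.div_eq_of_lt this, hP]
  have hPb : ∃ K, ∀ N, ‖P N‖ ≤ K := by
    obtain ⟨K, hK⟩ := (Metric.isBounded_range_of_tendsto P hD).exists_norm_le
    exact ⟨K, fun N => hK _ ⟨N, rfl⟩⟩
  obtain ⟨K, hK⟩ := hPb
  have hlim : Tendsto (fun N : ℕ => ∑' k, a k * P (N / k)) atTop (𝓝 (∑' k, a k * Dd)) := by
    refine tendsto_tsum_of_dominated_convergence (bound := fun k => ‖a k‖ * K)
      (hs.norm.mul_right K) ?_ ?_
    · intro k
      rcases Nat.eq_zero_or_pos k with rfl | hk0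
      · simp [ha0]
      · exact (hD.comp (Nat.tendsto_div_const_atTop hk0.ne')).const_mul _
    · refine Eventually.of_forall fun N k => ?_
      rw [norm_mul]
      gcongr
      exact hK _
  have hlim2 : Tendsto (fun N : ℕ => ∑ n ∈ Finset.Icc 1 N, Real.log n * a n) atTop
      (𝓝 (∑' n : ℕ, Real.log n * a n)) := by
    have := (hs'.hasSum.tendsto_sum_nat).comp (tendsto_add_atTop_nat 1)
    refine this.congr fun N => ?_
    simp only [Function.comp]
    rw [Finset.range_eq_Ico, Finset.sum_eq_sum_Ico_succ_bot (Nat.succ_pos N)]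
    rw [Nat.cast_zero, Real.log_zero, zero_mul, zero_add]
    rfl
  rw [tsum_mul_right] at hlim
  exact tendsto_nhds_unique hlim2 (hlim.congr fun N => (hsum N).symm)

lemma aux_term (f : ℕ → ℝ) (hf0 : f 0 = 0) (x : ℝ) (n : ℕ) :
    LSeries.term (fun n => (f n : ℂ)) (x : ℂ) n = ((f n * (n:ℝ) ^ (-x) : ℝ) : ℂ) := by
  rcases eq_or_ne n 0 with rfl | hn
  · simp [hf0]
  · rw [LSeries.term_of_ne_zero hn, Real.rpow_neg (Nat.cast_nonneg n)]
    push_cast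
    rw [Complex.ofReal_cpow (Nat.cast_nonneg n)]
    simp [div_eq_mul_inv]

lemma aux_F (f : ℕ → ℝ) (hf0 : f 0 = 0) (hf : ∀ n, 0 ≤ f n)
    (hS : ∀ ε : ℝ, 0 < ε → (fun n : ℕ => ∑ k ∈ Finset.Icc 1 n, f k) =O[atTop]
      fun n : ℕ => (n:ℝ) ^ (1 + ε)) (d : ℝ) (hd : 0 < d) :
    (Summable fun n : ℕ => f n * (n:ℝ) ^ (-(1 + d))) ∧
    (Summable fun n : ℕ => Real.log n * (f n * (n:ℝ) ^ (-(1 + d)))) ∧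
    HasDerivAt (fun y : ℝ => ∑' n : ℕ, f n * (n:ℝ) ^ (-(1 + y)))
      (-∑' n : ℕ, Real.log n * (f n * (n:ℝ) ^ (-(1 + d)))) d ∧
    ∑' n : ℕ, f n * (n:ℝ) ^ (-(1 + d)) =
      (1 + d) * ∫ t in Set.Ioi (1:ℝ), (∑ k ∈ Finset.Icc 1 ⌊t⌋₊, f k) * t ^ (-(2 + d)) := by
  have hLS : ∀ x : ℝ, 1 < x → LSeriesSummable (fun n => (f n : ℂ)) (x:ℂ) := by
    intro x hx
    refine LSeriesSummable_of_sum_norm_bigO_and_nonneg (hS ((x - 1) / 2) (by linarith)) hf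
      (by linarith) ?_
    rw [Complex.ofReal_re]; linarith
  have habs : LSeries.abscissaOfAbsConv (fun n => (f n : ℂ)) < (((1 + d : ℝ) : ℂ)).re := by
    refine lt_of_le_of_lt (LSeries.abscissaOfAbsConv_le_of_forall_lt_LSeriesSummable (x := 1)
      fun y hy => hLS y (by exact_mod_cast hy)) ?_
    rw [Complex.ofReal_re]
    exact_mod_cast (by linarith : (1:ℝ) < 1 + d)
  have hterm2 : ∀ n : ℕ, LSeries.term (LSeries.logMul (fun n => (f n : ℂ))) ((1 + d : ℝ) : ℂ) n
      = ((Real.log n * (f n * (n:ℝ) ^ (-(1 + d))) : ℝ) : ℂ) := by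
    intro n
    have h1 : LSeries.logMul (fun n => (f n : ℂ)) = fun n : ℕ => ((Real.log n * f n : ℝ) : ℂ) := by
      ext n
      simp [LSeries.logMul, Complex.natCast_log]
    rw [h1, aux_term (fun n => Real.log n * f n) (by simp), mul_assoc]
  have hLre : ∀ x : ℝ, (LSeries (fun n => (f n : ℂ)) (x:ℂ)).re =
      ∑' n : ℕ, f n * (n:ℝ) ^ (-x) := by
    intro x
    unfold LSeries
    rw [tsum_congr (aux_term f hf0 x), ← Complex.ofReal_tsum, Complex.ofReal_re]
  refine ⟨?_, ?_, ?_, ?_⟩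
  · have := hLS (1 + d) (by linarith)
    unfold LSeriesSummable at this
    rw [funext (aux_term f hf0 (1 + d))] at this
    exact_mod_cast this
  · have := LSeriesSummable_logMul_of_lt_re habs
    unfold LSeriesSummable at this
    rw [funext hterm2] at this
    exact_mod_cast this
  · have h1 := (LSeries_hasDerivAt habs).real_of_complex
    have h2 : (-LSeries (LSeries.logMul (fun n => (f n : ℂ))) ((1 + d : ℝ) : ℂ)).re =
        (-∑' n : ℕ, Real.log n * (f n * (n:ℝ) ^ (-(1 + d)))) := by
      unfold LSeries
      rw [tsum_congr hterm2, ← Complex.ofReal_tsum, Complex.neg_re, Complex.ofReal_re]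
    rw [h2] at h1
    have h3 := h1.comp_const_add 1 d
    simpa only [hLre] using h3
  · have h1 := LSeries_eq_mul_integral_of_nonneg f (r := 1 + d / 2) (by linarith)
      (s := ((1 + d : ℝ) : ℂ)) (by rw [Complex.ofReal_re]; linarith) (hS (d / 2) (by linarith)) hf
    have h2 := congrArg Complex.re h1
    rw [hLre] at h2
    rw [h2]
    have h3 : ∫ t in Set.Ioi (1 : ℝ), (∑ k ∈ Icc 1 ⌊t⌋₊, (f k : ℂ)) *
        (t:ℂ) ^ (-(((1 + d : ℝ) : ℂ) + 1)) =
        ((∫ t in Set.Ioi (1:ℝ), (∑ k ∈ Finset.Icc 1 ⌊t⌋₊, f k) * t ^ (-(2 + d)) : ℝ) : ℂ) := by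
      rw [← integral_complex_ofReal]
      refine MeasureTheory.setIntegral_congr_fun measurableSet_Ioi fun t ht => ?_
      have ht0 : (0:ℝ) ≤ t := by linarith [Set.mem_Ioi.mp ht]
      rw [Complex.ofReal_mul, Complex.ofReal_cpow ht0]
      push_cast
      congr 2
      ring
    rw [h3, ← Complex.ofReal_mul, Complex.ofReal_re]

lemma aux_M {τ : ℝ} (hτ : 0 < τ) (M : ℝ → ℝ)
    (hM : ∀ x, M x = ∫ t in (1:ℝ)..x, Real.log t ^ (τ - 1)) :
    (∀ x, 1 ≤ x → 0 ≤ M x) ∧ (∀ x y, 1 ≤ x → x ≤ y → M x ≤ M y) ∧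
    (ContinuousOn M (Set.Ioi 1)) ∧
    ∀ d : ℝ, 0 < d → MeasureTheory.IntegrableOn (fun x : ℝ => M x * x ^ (-(2 + d))) (Set.Ioi 1) ∧
      ∫ x in Set.Ioi (1:ℝ), M x * x ^ (-(2 + d)) = d ^ (-τ) * Real.Gamma τ / (1 + d) := by
  set w : ℝ → ℝ := fun t => Real.log t ^ (τ - 1) with hw
  have hwm : Measurable w := Real.measurable_log.pow_const _
  have hw0 : ∀ t, 1 < t → 0 ≤ w t := fun t ht => Real.rpow_nonneg (Real.log_nonneg ht.le) _
  have hle : ∀ {ε x t : ℝ}, 0 < ε → 1 < t → t ≤ x →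
      w t ≤ x ^ (1 + ε) * (w t * t ^ (-(1 + ε))) := by
    intro ε x t hε ht htx
    have ht0 : 0 < t := by linarith
    have h1 : t ^ (1 + ε) ≤ x ^ (1 + ε) := Real.rpow_le_rpow ht0.le htx (by linarith)
    have h2 : t ^ (1 + ε) * t ^ (-(1 + ε)) = 1 := by
      rw [← Real.rpow_add ht0]; simp
    have h3 : 0 ≤ w t * t ^ (-(1 + ε)) := mul_nonneg (hw0 t ht) (Real.rpow_nonneg ht0.le _)
    calc w t = t ^ (1 + ε) * (w t * t ^ (-(1 + ε))) := by
          rw [mul_left_comm, h2, mul_one]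
      _ ≤ _ := by gcongr
  have hwi : ∀ x : ℝ, MeasureTheory.IntegrableOn w (Set.Ioc 1 x) := by
    intro x
    have h1 := MeasureTheory.IntegrableOn.mono_set
      ((aux_gamma_int hτ one_pos).1.const_mul (x ^ (1 + (1:ℝ))))
      (show Set.Ioc (1:ℝ) x ⊆ Set.Ioi 1 from Set.Ioc_subset_Ioi_self)
    refine h1.mono' hwm.aestronglyMeasurable ?_
    filter_upwards [MeasureTheory.ae_restrict_mem measurableSet_Ioc] with t ht
    rw [Real.norm_of_nonneg (hw0 t ht.1)]
    exact hle one_pos ht.1 ht.2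
  have hwii : ∀ x : ℝ, 1 ≤ x → IntervalIntegrable w MeasureTheory.volume 1 x := by
    intro x hx
    exact (intervalIntegrable_iff_integrableOn_Ioc_of_le hx).mpr (hwi x)
  have hMI : ∀ x, 1 ≤ x → M x = ∫ t in Set.Ioc 1 x, w t := fun x hx => by
    rw [hM, intervalIntegral.integral_of_le hx]
  have hpos : ∀ x, 1 ≤ x → 0 ≤ M x := fun x hx => by
    rw [hMI x hx]
    exact MeasureTheory.setIntegral_nonneg measurableSet_Ioc fun t ht => hw0 t ht.1
  have hbd : ∀ ε x : ℝ, 0 < ε → 1 ≤ x → M x ≤ (ε ^ (-τ) * Real.Gamma τ) * x ^ (1 + ε) := by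
    intro ε x hε hx
    have hg := aux_gamma_int hτ hε
    rw [hMI x hx, mul_comm, ← hg.2, ← MeasureTheory.integral_const_mul]
    calc ∫ t in Set.Ioc 1 x, w t ≤ ∫ t in Set.Ioc 1 x, x ^ (1 + ε) * (w t * t ^ (-(1 + ε))) := by
          refine MeasureTheory.setIntegral_mono_on (hwi x)
            (MeasureTheory.IntegrableOn.mono_set (hg.1.const_mul _) Set.Ioc_subset_Ioi_self) measurableSet_Ioc ?_
          intro t ht
          exact hle hε ht.1 ht.2
      _ ≤ _ := by
          refine MeasureTheory.setIntegral_mono_set (hg.1.const_mul _) ?_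
            (Set.Ioc_subset_Ioi_self.eventuallyLE)
          filter_upwards [MeasureTheory.ae_restrict_mem measurableSet_Ioi] with t ht
          have ht1 : 1 < t := ht
          have := hw0 t ht
          have h3 : 0 ≤ t ^ (-(1 + ε)) := Real.rpow_nonneg (by linarith) _
          show 0 ≤ x ^ (1 + ε) * (w t * t ^ (-(1 + ε)))
          positivity
  have hder : ∀ x ∈ Set.Ioi (1:ℝ), HasDerivAt M (w x) x := by
    intro x hx
    have hx1 : 1 < x := hx
    rw [funext hM]
    refine intervalIntegral.integral_hasDerivAt_right (hwii x hx1.le)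
      hwm.stronglyMeasurable.stronglyMeasurableAtFilter ?_
    exact (Real.continuousAt_log (by linarith)).rpow_const (Or.inl (Real.log_pos hx1).ne')
  have hcont : ContinuousOn M (Set.Ioi 1) := fun x hx =>
    (hder x hx).continuousAt.continuousWithinAt
  refine ⟨hpos, ?_, hcont, ?_⟩
  · intro x y hx hxy
    rw [hMI x hx, hMI y (hx.trans hxy)]
    refine MeasureTheory.setIntegral_mono_set (hwi y) ?_
      (Set.Ioc_subset_Ioc_right hxy).eventuallyLE
    filter_upwards [MeasureTheory.ae_restrict_mem measurableSet_Ioc] with t ht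
    exact hw0 t ht.1
  · intro d hd
    set K := ((d / 2) ^ (-τ) * Real.Gamma τ) with hK
    have hd1 : (1 + d) ≠ 0 := by positivity
    have hi : MeasureTheory.IntegrableOn (fun x : ℝ => M x * x ^ (-(2 + d))) (Set.Ioi 1) := by
      refine ((aux_int1 (half_pos hd)).1.const_mul K).mono' ?_ ?_
      · exact (hcont.aestronglyMeasurable measurableSet_Ioi).mul
          (measurable_id.pow_const _).aestronglyMeasurable
      · filter_upwards [MeasureTheory.ae_restrict_mem measurableSet_Ioi] with t ht
        have ht1 : 1 < t := ht
        have ht0 : 0 < t := by linarith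
        have h3 : 0 ≤ t ^ (-(2 + d)) := Real.rpow_nonneg ht0.le _
        rw [Real.norm_of_nonneg (mul_nonneg (hpos t ht1.le) h3)]
        calc M t * t ^ (-(2 + d)) ≤ K * t ^ (1 + d / 2) * t ^ (-(2 + d)) := by
              gcongr
              exact hbd _ t (half_pos hd) ht1.le
          _ = K * t ^ (-(1 + d / 2)) := by
              rw [mul_assoc, ← Real.rpow_add ht0]; congr 2; ring
    refine ⟨hi, ?_⟩
    have hv : ∀ x ∈ Set.Ioi (1:ℝ), HasDerivAt (fun x : ℝ => -(1 + d)⁻¹ * x ^ (-(1 + d)))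
        (x ^ (-(2 + d))) x := by
      intro x hx
      have hx0 : x ≠ 0 := by linarith [Set.mem_Ioi.mp hx]
      have h1 := (Real.hasDerivAt_rpow_const (x := x) (p := -(1 + d)) (Or.inl hx0)).const_mul
        (-(1 + d)⁻¹)
      have e : -(1 + d)⁻¹ * (-(1 + d) * x ^ (-(1 + d) - 1)) = x ^ (-(2 + d)) := by
        rw [show -(1 + d) - 1 = -(2 + d) by ring]
        field_simp
      rw [e] at h1
      exact h1
    have hg := aux_gamma_int hτ hd
    have hp := MeasureTheory.integral_Ioi_mul_deriv_eq_deriv_mul (a := (1:ℝ)) (a' := 0) (b' := 0)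
      hder hv hi ?_ ?_ ?_
    · rw [hp]
      have : ∫ x in Set.Ioi (1:ℝ), w x * (-(1 + d)⁻¹ * x ^ (-(1 + d))) =
          -(1 + d)⁻¹ * ∫ x in Set.Ioi (1:ℝ), w x * x ^ (-(1 + d)) := by
        rw [← MeasureTheory.integral_const_mul]
        congr 1; ext x; ring
      rw [this, hg.2]
      field_simp
      ring
    · refine MeasureTheory.IntegrableOn.congr_fun (hg.1.const_mul (-(1 + d)⁻¹)) ?_ measurableSet_Ioi
      intro x _
      simp only [Pi.mul_apply, hw]; ring
    · have h1 : Tendsto M (𝓝[>] 1) (𝓝 0) := by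
        have h2 : ContinuousOn (fun x => ∫ t in (1:ℝ)..x, w t) (Set.uIcc 1 2) := by
          apply intervalIntegral.continuousOn_primitive_interval
          rw [Set.uIcc_of_le (by norm_num), integrableOn_Icc_iff_integrableOn_Ioc]
          exact hwi 2
        have h3 := h2 1 Set.left_mem_uIcc
        rw [Set.uIcc_of_le (by norm_num)] at h3
        have h4 : Tendsto (fun x => ∫ t in (1:ℝ)..x, w t) (𝓝[>] 1) (𝓝 0) := by
          have : (∫ t in (1:ℝ)..1, w t) = 0 := intervalIntegral.integral_same
          rw [← this]
          refine (h3.tendsto).mono_left ?_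
          rw [← nhdsWithin_Ioc_eq_nhdsGT (by norm_num : (1:ℝ) < 2)]
          exact nhdsWithin_mono _ Set.Ioc_subset_Icc_self
        exact h4.congr fun x => (hM x).symm
      have h2 : Tendsto (fun x : ℝ => -(1 + d)⁻¹ * x ^ (-(1 + d))) (𝓝[>] 1)
          (𝓝 (-(1 + d)⁻¹ * 1 ^ (-(1 + d)))) :=
        ((Real.continuousAt_rpow_const 1 _ (Or.inl one_ne_zero)).tendsto.mono_left
          nhdsWithin_le_nhds).const_mul _
      have := h1.mul h2
      rw [zero_mul] at this
      exact this
    · have h0 : Tendsto (fun x : ℝ => (1 + d)⁻¹ * (K * x ^ (-(d / 2)))) atTop (𝓝 0) := by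
        have := ((tendsto_rpow_neg_atTop (half_pos hd)).const_mul K).const_mul (1 + d)⁻¹
        simpa using this
      refine squeeze_zero_norm' ?_ h0
      filter_upwards [eventually_gt_atTop 1] with t ht
      have ht0 : 0 < t := by linarith
      have h3 : 0 ≤ t ^ (-(1 + d)) := Real.rpow_nonneg ht0.le _
      have h4 : (0:ℝ) ≤ (1 + d)⁻¹ := by positivity
      rw [Pi.mul_apply, norm_mul, norm_mul, norm_neg, Real.norm_of_nonneg (hpos t ht.le),
        Real.norm_of_nonneg h3, Real.norm_of_nonneg h4, mul_left_comm]
      refine mul_le_mul_of_nonneg_left ?_ h4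
      calc M t * t ^ (-(1 + d)) ≤ K * t ^ (1 + d / 2) * t ^ (-(1 + d)) := by
              gcongr
              exact hbd _ t (half_pos hd) ht.le
          _ = K * t ^ (-(d / 2)) := by
              rw [mul_assoc, ← Real.rpow_add ht0]; congr 2; ring

lemma aux_h {τ r C₁ : ℝ} (f : ℕ → ℝ) (hf : ∀ n, 0 ≤ f n) (hτ : 0 < τ) (hr : 2 - τ < r)
    (M : ℝ → ℝ) (hM : ∀ x, M x = ∫ t in (1:ℝ)..x, Real.log t ^ (τ - 1))
    (hS : ∀ ε : ℝ, 0 < ε → (fun x : ℝ => ∑ k ∈ Finset.Icc 1 ⌊x⌋₊, f k) =O[atTop]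
      fun x : ℝ => x ^ (1 + ε))
    (hO : (fun x : ℝ => (∑ n ∈ Finset.Icc 1 ⌊x⌋₊, f n) - C₁ * M x)
        =O[atTop] fun x : ℝ => x / Real.log x ^ r) :
    ∃ h : ℝ → ℝ, (∀ d : ℝ, 0 < d → h d =
      (∫ t in Set.Ioi (1:ℝ), (∑ k ∈ Finset.Icc 1 ⌊t⌋₊, f k) * t ^ (-(2 + d)))
        - C₁ * (d ^ (-τ) * Real.Gamma τ / (1 + d))) ∧
      Tendsto (fun d => d ^ (τ - 1) * (h d - h (2 * d))) (𝓝[>] 0) (𝓝 0) := by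
  obtain ⟨hMpos, hMmono, hMcont, hMint⟩ := aux_M hτ M hM
  set S : ℝ → ℝ := fun x => ∑ k ∈ Finset.Icc 1 ⌊x⌋₊, f k with hSdef
  have hSm : Measurable S := aux_meas_sum f
  have hS0 : ∀ x, 0 ≤ S x := fun x => Finset.sum_nonneg fun n _ => hf n
  have hSmono : ∀ x y, x ≤ y → S x ≤ S y := by
    intro x y hxy
    apply Finset.sum_le_sum_of_subset_of_nonneg
    · exact Finset.Icc_subset_Icc le_rfl (Nat.floor_mono hxy)
    · intros; exact hf _
  have hSi : ∀ d : ℝ, 0 < d → MeasureTheory.IntegrableOn (fun x : ℝ => S x * x ^ (-(2 + d)))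
      (Set.Ioi 1) := by
    intro d hd
    obtain ⟨K, hK⟩ := (hS (d / 2) (half_pos hd)).bound
    obtain ⟨x0, hx0⟩ := eventually_atTop.mp hK
    have hb : ∀ t, 1 < t → S t ≤ (|K| + S x0) * t ^ (1 + d / 2) := by
      intro t ht
      have h1 : 1 ≤ t ^ (1 + d / 2) := Real.one_le_rpow ht.le (by positivity)
      rcases le_total x0 t with h | h
      · have h2 := hx0 t h
        rw [Real.norm_of_nonneg (hS0 t), Real.norm_of_nonneg (by linarith)] at h2
        refine h2.trans ?_
        gcongr
        linarith [le_abs_self K, hS0 x0]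
      · have h2 := hSmono t x0 h
        have h3 : (0:ℝ) ≤ |K| := abs_nonneg K
        have h4 := hS0 x0
        nlinarith
    refine ((aux_int1 (half_pos hd)).1.const_mul (|K| + S x0)).mono' ?_ ?_
    · exact (hSm.mul (measurable_id.pow_const _)).aestronglyMeasurable
    · filter_upwards [MeasureTheory.ae_restrict_mem measurableSet_Ioi] with t ht
      have ht1 : 1 < t := ht
      have ht0 : 0 < t := by linarith
      have h3 : 0 ≤ t ^ (-(2 + d)) := Real.rpow_nonneg ht0.le _
      rw [Real.norm_of_nonneg (mul_nonneg (hS0 t) h3)]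
      calc S t * t ^ (-(2 + d)) ≤ (|K| + S x0) * t ^ (1 + d / 2) * t ^ (-(2 + d)) := by
            gcongr
            exact hb t ht
        _ = (|K| + S x0) * t ^ (-(1 + d / 2)) := by
            rw [mul_assoc, ← Real.rpow_add ht0]; congr 2; ring
  set E : ℝ → ℝ := fun x => S x - C₁ * M x with hE
  have hEi : ∀ d : ℝ, 0 < d → MeasureTheory.IntegrableOn (fun x : ℝ => E x * x ^ (-(2 + d)))
      (Set.Ioi 1) := by
    intro d hd
    refine MeasureTheory.IntegrableOn.congr_fun
      ((hSi d hd).sub ((hMint d hd).1.const_mul C₁)) ?_ measurableSet_Ioi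
    intro x _
    simp only [hE, Pi.sub_apply]; ring
  refine ⟨fun d => ∫ t in Set.Ioi (1:ℝ), E t * t ^ (-(2 + d)), ?_, ?_⟩
  · intro d hd
    rw [← (hMint d hd).2, ← MeasureTheory.integral_const_mul,
      ← MeasureTheory.integral_sub (hSi d hd) ((hMint d hd).1.const_mul C₁)]
    refine MeasureTheory.setIntegral_congr_fun measurableSet_Ioi fun t _ => ?_
    simp only [hE]; ring
  -- reduce `r`
  obtain ⟨q, hq1, hq2, hqr⟩ : ∃ q, 2 - τ < q ∧ q < 2 ∧ q ≤ r :=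
    ⟨min r (2 - τ / 2), lt_min hr (by linarith), (min_le_right _ _).trans_lt (by linarith),
      min_le_left _ _⟩
  obtain ⟨K, K', hK0, hK'0, hEb⟩ : ∃ K K' : ℝ, 0 ≤ K ∧ 0 ≤ K' ∧
      ∀ t, 1 < t → |E t| ≤ K * (t * Real.log t ^ (-q)) + K' := by
    obtain ⟨K, hK⟩ := hO.bound
    obtain ⟨x0, hx0⟩ := eventually_atTop.mp hK
    set x := max x0 (Real.exp 1) with hx
    have hx1 : 1 ≤ x := (Real.one_le_exp zero_le_one).trans (le_max_right _ _)
    refine ⟨|K|, S x + |C₁| * M x, abs_nonneg _, ?_, ?_⟩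
    · have := hS0 x
      have := hMpos x hx1
      positivity
    intro t ht
    have ht0 : 0 < t := by linarith
    have hl : 0 < Real.log t := Real.log_pos ht
    rcases le_total x t with h | h
    · have h1 := hx0 t ((le_max_left _ _).trans h)
      have h2 : 1 ≤ Real.log t := by
        rw [Real.le_log_iff_exp_le ht0]
        exact (le_max_right _ _).trans h
      have h3 : ‖t / Real.log t ^ r‖ ≤ t * Real.log t ^ (-q) := by
        rw [Real.norm_of_nonneg (by positivity), div_eq_mul_inv, ← Real.rpow_neg hl.le]
        gcongr
      rw [Real.norm_eq_abs] at h1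
      have h4 := hS0 x
      have h5 := hMpos x hx1
      calc |E t| ≤ K * ‖t / Real.log t ^ r‖ := h1
        _ ≤ |K| * (t * Real.log t ^ (-q)) := by
            gcongr
            exact le_abs_self K
        _ ≤ _ := le_add_of_nonneg_right (by positivity)
    · have h1 : |E t| ≤ S x + |C₁| * M x := by
        refine (abs_sub _ _).trans ?_
        rw [abs_mul, abs_of_nonneg (hS0 t), abs_of_nonneg (hMpos t ht.le)]
        have := hSmono t x h
        have := hMmono t x ht.le h
        gcongr
      refine h1.trans (le_add_of_nonneg_left (by positivity))
  have hbound : ∀ d : ℝ, 0 < d → |(∫ t in Set.Ioi (1:ℝ), E t * t ^ (-(2 + d))) -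
      ∫ t in Set.Ioi (1:ℝ), E t * t ^ (-(2 + 2 * d))| ≤
      d * (K * (d ^ (-(2 - q)) * Real.Gamma (2 - q)) + K') := by
    intro d hd
    have hg := aux_gamma_int (by linarith : 0 < 2 - q) hd
    have h2 := aux_int2 one_pos
    rw [← MeasureTheory.integral_sub (hEi d hd) (hEi (2 * d) (by linarith))]
    have hI : MeasureTheory.IntegrableOn (fun t : ℝ =>
        K * (Real.log t ^ (2 - q - 1) * t ^ (-(1 + d))) +
        K' * (Real.log t * t ^ (-(1 + (1:ℝ))))) (Set.Ioi 1) :=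
      (hg.1.const_mul K).add (h2.1.const_mul K')
    have hv : d * (K * (d ^ (-(2 - q)) * Real.Gamma (2 - q)) + K') =
        ∫ t in Set.Ioi (1:ℝ), d * (K * (Real.log t ^ (2 - q - 1) * t ^ (-(1 + d))) +
        K' * (Real.log t * t ^ (-(1 + (1:ℝ))))) := by
      rw [MeasureTheory.integral_const_mul,
        MeasureTheory.integral_add (hg.1.const_mul K) (h2.1.const_mul K'),
        MeasureTheory.integral_const_mul, MeasureTheory.integral_const_mul, hg.2, h2.2]
      simp
    rw [hv, ← Real.norm_eq_abs]
    refine MeasureTheory.norm_integral_le_of_norm_le (hI.const_mul d) ?_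
    filter_upwards [MeasureTheory.ae_restrict_mem measurableSet_Ioi] with t ht
    have ht1 : 1 < t := ht
    have ht0 : 0 < t := by linarith
    have hl : 0 < Real.log t := Real.log_pos ht
    have e1 : t ^ (-(2 + 2 * d)) = t ^ (-(2 + d)) * t ^ (-d) := by
      rw [← Real.rpow_add ht0]; congr 1; ring
    have e2 : 1 - t ^ (-d) ≤ d * Real.log t := by
      rw [Real.rpow_def_of_pos ht0]
      have := Real.add_one_le_exp (Real.log t * -d)
      linarith
    have e3 : 0 ≤ 1 - t ^ (-d) := by
      have := Real.rpow_le_one_of_one_le_of_nonpos ht1.le (by linarith : -d ≤ 0)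
      linarith
    have e4 : 0 ≤ t ^ (-(2 + d)) := Real.rpow_nonneg ht0.le _
    have e5 : t * t ^ (-(2 + d)) = t ^ (-(1 + d)) := by
      nth_rewrite 1 [← Real.rpow_one t]
      rw [← Real.rpow_add ht0]; congr 1; ring
    have e6 : Real.log t ^ (-q) * Real.log t = Real.log t ^ (2 - q - 1) := by
      nth_rewrite 2 [← Real.rpow_one (Real.log t)]
      rw [← Real.rpow_add hl]; congr 1; ring
    have e7 : t ^ (-(2 + d)) ≤ t ^ (-(1 + (1:ℝ))) :=
      Real.rpow_le_rpow_of_exponent_le ht1.le (by linarith)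
    have e8 : E t * t ^ (-(2 + d)) - E t * t ^ (-(2 + 2 * d)) =
        E t * (t ^ (-(2 + d)) * (1 - t ^ (-d))) := by rw [e1]; ring
    rw [e8, norm_mul, Real.norm_eq_abs, Real.norm_of_nonneg (mul_nonneg e4 e3)]
    have hq0 : 0 ≤ Real.log t ^ (-q) := Real.rpow_nonneg hl.le _
    calc |E t| * (t ^ (-(2 + d)) * (1 - t ^ (-d)))
        ≤ (K * (t * Real.log t ^ (-q)) + K') * (t ^ (-(2 + d)) * (d * Real.log t)) := by
          gcongr
          exact hEb t ht
      _ = d * (K * ((Real.log t ^ (-q) * Real.log t) * (t * t ^ (-(2 + d)))) +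
            K' * (Real.log t * t ^ (-(2 + d)))) := by ring
      _ ≤ _ := by
          rw [e5, e6]
          gcongr
  set G := K * Real.Gamma (2 - q) with hG
  have hlim : Tendsto (fun d : ℝ => G * d ^ (τ - 2 + q) + K' * d ^ τ) (𝓝[>] 0) (𝓝 0) := by
    have hz : ∀ p : ℝ, 0 < p → Tendsto (fun d : ℝ => d ^ p) (𝓝[>] 0) (𝓝 0) := by
      intro p hp
      have := (Real.continuousAt_rpow_const 0 p (Or.inr hp.le)).tendsto
      rw [Real.zero_rpow hp.ne'] at this
      exact this.mono_left nhdsWithin_le_nhds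
    have := ((hz (τ - 2 + q) (by linarith)).const_mul G).add ((hz τ hτ).const_mul K')
    simpa using this
  refine squeeze_zero_norm' ?_ hlim
  filter_upwards [self_mem_nhdsWithin] with d hd
  have hd : 0 < d := hd
  have h1 : 0 ≤ d ^ (τ - 1) := Real.rpow_nonneg hd.le _
  rw [norm_mul, Real.norm_of_nonneg h1, Real.norm_eq_abs]
  calc _ ≤ d ^ (τ - 1) * (d * (K * (d ^ (-(2 - q)) * Real.Gamma (2 - q)) + K')) := by
        gcongr
        exact hbound d hd
    _ = G * (d ^ (τ - 1) * d * d ^ (-(2 - q))) + K' * (d ^ (τ - 1) * d) := by rw [hG]; ring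
    _ = _ := by
        have e1 : d ^ (τ - 1) * d = d ^ τ := by
          nth_rewrite 2 [← Real.rpow_one d]
          rw [← Real.rpow_add hd]; congr 1; ring
        rw [e1, ← Real.rpow_add hd]
        congr 3; ring

lemma aux_core (f : ℕ → ℝ) (τ B C₁ r : ℝ) (hf0 : f 0 = 0) (hf1 : f 1 = 1) (hf : ∀ n, 0 ≤ f n)
    (hτ : 0 < τ) (hτ1 : τ ≠ 1)
    (Λf : ℕ → ℝ)
    (hΛf : ∀ n : ℕ, 1 ≤ n → f n * Real.log n = ∑ d ∈ n.divisors, f d * Λf (n / d))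
    (hB : Tendsto (fun x : ℝ => (∑ n ∈ Finset.Icc 1 ⌊x⌋₊, Λf n / n) - τ * Real.log x)
        atTop (𝓝 B))
    (hC₁ : Tendsto (fun x : ℝ => (∑ n ∈ Finset.Icc 1 ⌊x⌋₊, f n) * Real.log x ^ (1 - τ) / x)
        atTop (𝓝 C₁))
    (hr : 2 - τ < r)
    (hO : (fun x : ℝ => (∑ n ∈ Finset.Icc 1 ⌊x⌋₊, f n)
          - C₁ * ∫ t in (1:ℝ)..x, 1 / Real.log t ^ (1 - τ))
        =O[atTop] fun x : ℝ => x / Real.log x ^ r) :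
    B = 0 := by
  have hS : ∀ ε : ℝ, 0 < ε → (fun x : ℝ => ∑ k ∈ Finset.Icc 1 ⌊x⌋₊, f k) =O[atTop]
      fun x : ℝ => x ^ (1 + ε) := by
    intro ε hε
    have h1 := hC₁.isBigO_one ℝ
    have h2 : (fun x : ℝ => x * Real.log x ^ (τ - 1)) =O[atTop] fun x : ℝ => x * x ^ ε :=
      (isBigO_refl _ _).mul (isLittleO_log_rpow_rpow_atTop (τ - 1) hε).isBigO
    refine (h1.mul h2).congr' ?_ ?_
    · filter_upwards [eventually_gt_atTop 1] with x hx
      have hl : 0 < Real.log x := Real.log_pos hx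
      have hx0 : x ≠ 0 := by linarith
      have e : Real.log x ^ (1 - τ) * Real.log x ^ (τ - 1) = 1 := by
        rw [← Real.rpow_add hl]; simp
      calc _ = (∑ n ∈ Finset.Icc 1 ⌊x⌋₊, f n) * (Real.log x ^ (1 - τ) * Real.log x ^ (τ - 1))
            * (x / x) := by ring
        _ = _ := by rw [e, div_self hx0, mul_one, mul_one]
    · filter_upwards [eventually_gt_atTop 1] with x hx
      rw [one_mul, Real.rpow_add (by linarith), Real.rpow_one]
  have hSn : ∀ ε : ℝ, 0 < ε → (fun n : ℕ => ∑ k ∈ Finset.Icc 1 n, f k) =O[atTop]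
      fun n : ℕ => (n:ℝ) ^ (1 + ε) := by
    intro ε hε
    have := (hS ε hε).comp_tendsto (tendsto_natCast_atTop_atTop (R := ℝ))
    simpa [Function.comp_def] using this
  set M : ℝ → ℝ := fun x => ∫ t in (1:ℝ)..x, Real.log t ^ (τ - 1) with hM
  have hO' : (fun x : ℝ => (∑ n ∈ Finset.Icc 1 ⌊x⌋₊, f n) - C₁ * M x)
        =O[atTop] fun x : ℝ => x / Real.log x ^ r := by
    refine hO.congr' ?_ EventuallyEq.rfl
    filter_upwards [eventually_ge_atTop 1] with x hx
    congr 2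
    refine intervalIntegral.integral_congr fun t ht => ?_
    rw [Set.uIcc_of_le hx] at ht
    have hl : 0 ≤ Real.log t := Real.log_nonneg ht.1
    show 1 / Real.log t ^ (1 - τ) = Real.log t ^ (τ - 1)
    rw [one_div, ← Real.rpow_neg hl]; congr 1; ring
  obtain ⟨h, hh, hhd⟩ := aux_h f hf hτ hr M (fun _ => rfl) hS hO'
  obtain ⟨D, hD, hDB⟩ := aux_D (fun n => Λf n / n) (by simp) τ B hB
  set F : ℝ → ℝ := fun y => ∑' n : ℕ, f n * (n:ℝ) ^ (-(1 + y)) with hF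
  have hFpos : ∀ d : ℝ, 0 < d → 0 < F d := by
    intro d hd
    have h1 := (aux_F f hf0 hf hSn d hd).1.le_tsum 1 (fun n _ => mul_nonneg (hf n)
      (Real.rpow_nonneg (Nat.cast_nonneg n) _))
    simp only [Nat.cast_one, Real.one_rpow, hf1, mul_one] at h1
    exact lt_of_lt_of_le one_pos h1
  have hFd : ∀ d : ℝ, 0 < d → HasDerivAt F (-(F d * D d)) d := by
    intro d hd
    obtain ⟨h1, h2, h3, _⟩ := aux_F f hf0 hf hSn d hd
    rw [aux_mertens f Λf d (D d) hf0 h1 h2 hΛf (hD d hd)] at h3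
    exact h3
  have hFI : ∀ d : ℝ, 0 < d → (1 + d) * d ^ τ * h d = d ^ τ * F d - C₁ * Real.Gamma τ := by
    intro d hd
    have h4 := (aux_F f hf0 hf hSn d hd).2.2.2
    have h5 : F d = (1 + d) *
      ∫ t in Set.Ioi (1:ℝ), (∑ k ∈ Finset.Icc 1 ⌊t⌋₊, f k) * t ^ (-(2 + d)) := h4
    have e : d ^ τ * d ^ (-τ) = 1 := by rw [← Real.rpow_add hd]; simp
    have hd1 : (1 + d) ≠ 0 := by positivity
    rw [hh d hd, h5]
    calc _ = d ^ τ * ((1 + d) *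
      ∫ t in Set.Ioi (1:ℝ), (∑ k ∈ Finset.Icc 1 ⌊t⌋₊, f k) * t ^ (-(2 + d)))
        - C₁ * Real.Gamma τ * (d ^ τ * d ^ (-τ)) * ((1 + d) / (1 + d)) := by ring
      _ = _ := by rw [e, div_self hd1]; ring
  have hLd : ∀ d : ℝ, 0 < d → HasDerivAt (fun d => τ * Real.log d + Real.log (F d))
      (-(D d - τ / d)) d := by
    intro d hd
    have h1 := ((Real.hasDerivAt_log hd.ne').const_mul τ).add ((hFd d hd).log (hFpos d hd).ne')
    have e : τ * d⁻¹ + -(F d * D d) / F d = -(D d - τ / d) := by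
      have := (hFpos d hd).ne'
      field_simp
      ring
    rw [e] at h1
    exact h1
  obtain ⟨g, hg, hgl⟩ := aux_lip hLd hDB.neg
  have hgl' : Tendsto (fun d => (d ^ τ * F d - g) / d) (𝓝[>] 0) (𝓝 (g * -B)) := by
    refine hgl.congr' ?_
    filter_upwards [self_mem_nhdsWithin] with d hd
    have hd : 0 < d := hd
    rw [Real.exp_add, Real.exp_log (hFpos d hd), mul_comm τ, ← Real.rpow_def_of_pos hd]
  have hid : Tendsto (fun d : ℝ => d) (𝓝[>] 0) (𝓝 0) :=
    tendsto_id.mono_left nhdsWithin_le_nhds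
  have hone : Tendsto (fun d : ℝ => (1 + d)⁻¹) (𝓝[>] 0) (𝓝 1) := by
    have := (hid.const_add 1).inv₀ (by norm_num)
    simpa using this
  have hG : Tendsto (fun d => d ^ τ * F d) (𝓝[>] 0) (𝓝 g) := by
    have := (hgl'.mul hid).add_const g
    rw [mul_zero, zero_add] at this
    refine this.congr' ?_
    filter_upwards [self_mem_nhdsWithin] with d hd
    have hd : d ≠ 0 := (Set.mem_Ioi.mp hd).ne'
    field_simp
    ring
  have hgA : g - C₁ * Real.Gamma τ = 0 := by
    refine aux_dyadic (h := h) hτ.ne' ?_ ?_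
    · have := hone.mul (hG.sub_const (C₁ * Real.Gamma τ))
      rw [one_mul] at this
      refine this.congr' ?_
      filter_upwards [self_mem_nhdsWithin] with d hd
      have hd : 0 < d := hd
      rw [← hFI d hd]
      field_simp
    · have := hid.mul hhd
      rw [zero_mul] at this
      refine this.congr' ?_
      filter_upwards [self_mem_nhdsWithin] with d hd
      have hd : 0 < d := hd
      rw [← mul_assoc]
      congr 1
      nth_rewrite 1 [← Real.rpow_one d]
      rw [← Real.rpow_add hd]; congr 1; ring
  have hgB : g * -B = 0 := by
    refine aux_dyadic (h := h) (sub_ne_zero.mpr hτ1) ?_ hhd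
    have := hone.mul hgl'
    rw [one_mul] at this
    refine this.congr' ?_
    filter_upwards [self_mem_nhdsWithin] with d hd
    have hd : 0 < d := hd
    have e : g = C₁ * Real.Gamma τ := by linarith
    rw [e, ← hFI d hd, Real.rpow_sub hd, Real.rpow_one]
    field_simp
  rcases mul_eq_zero.mp hgB with h | h
  · exact absurd h hg.ne'
  · linarith

lemma aux_nonneg (f : ℕ → ℝ) (hf1 : f 1 = 1)
    (hfmult : ∀ m n : ℕ, Nat.Coprime m n → f (m * n) = f m * f n)
    (hb : ∀ p r : ℕ, p.Prime → 1 ≤ r → 0 ≤ f (p ^ r)) (n : ℕ) (hn : n ≠ 0) : 0 ≤ f n := by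
  induction n using Nat.recOnPosPrimePosCoprime with
  | prime_pow p k hp hk => exact hb p k hp hk
  | zero => exact absurd rfl hn
  | one => rw [hf1]; norm_num
  | coprime a b ha hb' hab iha ihb =>
    rw [hfmult a b hab]
    exact mul_nonneg (iha (by omega)) (ihb (by omega))

theorem moree_corollary_B_eq_zero
    (f : ℕ → ℝ) (c₁ c₂ τ ρ B C₁ r : ℝ)
    (hf1 : f 1 = 1)
    (hfmult : ∀ m n : ℕ, Nat.Coprime m n → f (m * n) = f m * f n)
    (hc₁ : 1 ≤ c₁) (hc₂ : 1 ≤ c₂) (hc₂' : c₂ < 2)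
    (hbound : ∀ p r : ℕ, p.Prime → 1 ≤ r → 0 ≤ f (p ^ r) ∧ f (p ^ r) ≤ c₁ * c₂ ^ r)
    (hτ : 0 < τ) (hτ1 : τ ≠ 1) (hρ : 1 < ρ)
    (hprimes : (fun x : ℝ => (∑ p ∈ (Finset.Icc 1 ⌊x⌋₊).filter Nat.Prime, f p)
        - τ * ∫ t in (2:ℝ)..x, 1 / Real.log t) =O[atTop]
        fun x : ℝ => x * Real.log x ^ (-2 - ρ))
    (Λf : ℕ → ℝ)
    (hΛf : ∀ n : ℕ, 1 ≤ n → f n * Real.log n = ∑ d ∈ n.divisors, f d * Λf (n / d))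
    (hB : Tendsto (fun x : ℝ => (∑ n ∈ Finset.Icc 1 ⌊x⌋₊, Λf n / n) - τ * Real.log x)
        atTop (𝓝 B))
    (hC₁ : Tendsto (fun x : ℝ => (∑ n ∈ Finset.Icc 1 ⌊x⌋₊, f n) * Real.log x ^ (1 - τ) / x)
        atTop (𝓝 C₁))
    (hr : 2 - τ < r)
    (hO : (fun x : ℝ => (∑ n ∈ Finset.Icc 1 ⌊x⌋₊, f n)
          - C₁ * ∫ t in (1:ℝ)..x, 1 / Real.log t ^ (1 - τ))
        =O[atTop] fun x : ℝ => x / Real.log x ^ r) :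
    B = 0 := by
  set f' : ℕ → ℝ := fun n => if n = 0 then 0 else f n with hf'
  have hff : ∀ n : ℕ, n ≠ 0 → f' n = f n := fun n hn => by simp [hf', hn]
  have hsum : ∀ N : ℕ, ∑ n ∈ Finset.Icc 1 N, f' n = ∑ n ∈ Finset.Icc 1 N, f n := fun N =>
    Finset.sum_congr rfl fun n hn => hff n (by have := (Finset.mem_Icc.mp hn).1; omega)
  refine aux_core f' τ B C₁ r (by simp [hf']) (by simp [hf', hf1]) ?_ hτ hτ1 Λf ?_ hB ?_ hr ?_
  · intro n
    rcases eq_or_ne n 0 with rfl | hn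
    · simp [hf']
    · rw [hff n hn]
      exact aux_nonneg f hf1 hfmult (fun p r hp hr => (hbound p r hp hr).1) n hn
  · intro n hn
    rw [hff n (by omega), hΛf n hn]
    refine Finset.sum_congr rfl fun d hd => ?_
    rw [hff d (Nat.pos_of_mem_divisors hd).ne']
  · simpa only [hsum] using hC₁
  · simpa only [hsum] using hO
end

section
/- Let k > 1 be a real number and let x ≥ 7481. Assuming that 0.98·y ≤ θ(y) ≤ 1.017·y for all y ≥ 7481, where θ(y) = ∑_{p ≤ y, p prime} log p is the Chebyshev theta function, one has ∑_{p > x, p prime} (log p)/(p^k − 1) ≤ (x/(x^k − 1))·(−0.98 + 1.017·k/(k−1)). -/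
open Filter Finset

lemma tail_aux (k x b : ℝ) (hk : 1 < k) (hx : (7481 : ℝ) ≤ x) (hb : x ≤ b)
    (hθ : ∀ y : ℝ, (7481 : ℝ) ≤ y →
      0.98 * y ≤ (∑ p ∈ (Finset.Icc 1 ⌊y⌋₊).filter Nat.Prime, Real.log p) ∧
      (∑ p ∈ (Finset.Icc 1 ⌊y⌋₊).filter Nat.Prime, Real.log p) ≤ 1.017 * y) :
    ∑ n ∈ Finset.Ioc ⌊x⌋₊ ⌊b⌋₊, (n : ℝ) ^ (-k) * (if n.Prime then Real.log n else 0)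
      ≤ x ^ (1 - k) * (-0.98 + 1.017 * k / (k - 1)) := by
  set c : ℕ → ℝ := fun n => if n.Prime then Real.log n else 0 with hc
  have hθ' : ∀ y : ℝ, x ≤ y → 0.98 * y ≤ ∑ n ∈ Finset.Icc 0 ⌊y⌋₊, c n ∧
      ∑ n ∈ Finset.Icc 0 ⌊y⌋₊, c n ≤ 1.017 * y := by
    intro y hy
    have h := hθ y (hx.trans hy)
    have e : ∑ n ∈ Finset.Icc 0 ⌊y⌋₊, c n
        = ∑ p ∈ (Finset.Icc 1 ⌊y⌋₊).filter Nat.Prime, Real.log p := by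
      rw [hc, ← Finset.sum_filter]
      apply Finset.sum_congr _ (fun _ _ => rfl)
      ext n
      simp only [Finset.mem_filter, Finset.mem_Icc]
      constructor
      · rintro ⟨h1, h2⟩
        exact ⟨⟨h2.one_le, h1.2⟩, h2⟩
      · rintro ⟨h1, h2⟩
        exact ⟨⟨Nat.zero_le _, h1.2⟩, h2⟩
    rw [e]; exact h
  have hx0 : 0 < x := by linarith
  have hb0 : 0 < b := by linarith
  have hk1 : 0 < k - 1 := by linarith
  have hder : ∀ t : ℝ, 0 < t → HasDerivAt (fun t : ℝ => t ^ (-k)) (-k * t ^ (-k - 1)) t := by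
    intro t ht
    exact Real.hasDerivAt_rpow_const (Or.inl ht.ne')
  have hcont : ∀ r : ℝ, ContinuousOn (fun t : ℝ => t ^ r) (Set.Icc x b) := by
    intro r t ht
    exact (Real.continuousAt_rpow_const _ _ (Or.inl (by linarith [ht.1]))).continuousWithinAt
  have hdi : MeasureTheory.IntegrableOn (deriv (fun t : ℝ => t ^ (-k))) (Set.Icc x b) := by
    apply MeasureTheory.IntegrableOn.congr_fun (f := fun t : ℝ => -k * t ^ (-k - 1)) _ _
      measurableSet_Icc
    · exact (continuousOn_const.mul (hcont _)).integrableOn_Icc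
    · intro t ht
      exact (hder t (by linarith [ht.1])).deriv.symm
  have hab := sum_mul_eq_sub_sub_integral_mul c hx0.le hb
    (f := fun t : ℝ => t ^ (-k)) (fun t ht => (hder t (by linarith [ht.1])).differentiableAt) hdi
  have hint := integrableOn_mul_sum_Icc c (m := 0) hx0.le hdi
  rw [hab]
  have hI : ∫ t in Set.Ioc x b, (-(1.017 * k)) * t ^ (-k) ≤
      ∫ t in Set.Ioc x b, deriv (fun t : ℝ => t ^ (-k)) t * ∑ n ∈ Finset.Icc 0 ⌊t⌋₊, c n := by
    apply MeasureTheory.setIntegral_mono_on _ (hint.mono_set Set.Ioc_subset_Icc_self)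
      measurableSet_Ioc
    · intro t ht
      have ht0 : 0 < t := by linarith [ht.1]
      rw [(hder t ht0).deriv]
      have h1 := (hθ' t ht.1.le).2
      have h2 : t ^ (-k) = t ^ (-k - 1) * t := by
        rw [← Real.rpow_add_one ht0.ne']; congr 1; ring
      rw [h2]
      have h3 : 0 < k * t ^ (-k - 1) := by positivity
      nlinarith [mul_le_mul_of_nonneg_left h1 h3.le]
    · exact ((continuousOn_const.mul (hcont _)).integrableOn_Icc).mono_set Set.Ioc_subset_Icc_self
  have hI2 : ∫ t in Set.Ioc x b, (-(1.017 * k)) * t ^ (-k)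
      = -(1.017 * k / (k - 1)) * (x ^ (1 - k) - b ^ (1 - k)) := by
    rw [← intervalIntegral.integral_of_le hb, intervalIntegral.integral_const_mul,
      integral_rpow]
    · have : -k + 1 = 1 - k := by ring
      rw [this]
      have h1 : (1 - k) ≠ 0 := by linarith
      field_simp
      ring
    · right
      refine ⟨by linarith, ?_⟩
      rw [Set.uIcc_of_le hb]
      intro h; linarith [h.1]
  rw [hI2] at hI
  have e1 : ∀ t : ℝ, 0 < t → t ^ (1 - k) = t ^ (-k) * t := by
    intro t ht
    rw [← Real.rpow_add_one ht.ne']; congr 1; ring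
  have hA : b ^ (-k) * ∑ n ∈ Finset.Icc 0 ⌊b⌋₊, c n ≤ 1.017 * b ^ (1 - k) := by
    rw [e1 b hb0]
    nlinarith [mul_le_mul_of_nonneg_left (hθ' b hb).2 (Real.rpow_nonneg hb0.le (-k))]
  have hB : 0.98 * x ^ (1 - k) ≤ x ^ (-k) * ∑ n ∈ Finset.Icc 0 ⌊x⌋₊, c n := by
    rw [e1 x hx0]
    nlinarith [mul_le_mul_of_nonneg_left (hθ' x le_rfl).1 (Real.rpow_nonneg hx0.le (-k))]
  have hq : 1.017 ≤ 1.017 * k / (k - 1) := by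
    rw [le_div_iff₀ hk1]; linarith
  have hbp : 0 ≤ b ^ (1 - k) := Real.rpow_nonneg hb0.le _
  have hlast := mul_le_mul_of_nonneg_right hq hbp
  nlinarith

/-- The tail estimate `∑_{p > x} (log p)/(p^k - 1) ≤ (x/(x^k-1))(-0.98 + 1.017 k/(k-1))`
for `k > 1` and `x ≥ 7481`, assuming `0.98 y ≤ θ(y) ≤ 1.017 y` for `y ≥ 7481`, where
`θ(y) = ∑_{p ≤ y} log p` is Chebyshev's theta function. -/
theorem tail_prime_sum_bound
    (k x : ℝ) (hk : 1 < k) (hx : (7481 : ℝ) ≤ x)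
    (hθ : ∀ y : ℝ, (7481 : ℝ) ≤ y →
      0.98 * y ≤ (∑ p ∈ (Finset.Icc 1 ⌊y⌋₊).filter Nat.Prime, Real.log p) ∧
      (∑ p ∈ (Finset.Icc 1 ⌊y⌋₊).filter Nat.Prime, Real.log p) ≤ 1.017 * y) :
    (∑' p : {p : ℕ // p.Prime ∧ x < (p : ℝ)}, Real.log p.1 / ((p.1 : ℝ) ^ k - 1))
      ≤ x / (x ^ k - 1) * (-0.98 + 1.017 * k / (k - 1)) := by
  have hx0 : 0 < x := by linarith
  have hk1 : 0 < k - 1 := by linarith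
  have hxk : 1 < x ^ k := Real.one_lt_rpow (by linarith) (by linarith)
  have hxk1 : 0 < x ^ k - 1 := by linarith
  have hq : 1.017 ≤ 1.017 * k / (k - 1) := by
    rw [le_div_iff₀ hk1]; linarith
  have hpos : 0 ≤ x / (x ^ k - 1) * (-0.98 + 1.017 * k / (k - 1)) := by
    apply mul_nonneg (by positivity)
    linarith
  apply tsum_le_of_sum_le' hpos
  intro s
  set b : ℝ := x + ∑ p ∈ s, (p.1 : ℝ) with hbdef
  have hb : x ≤ b := by
    have : 0 ≤ ∑ p ∈ s, (p.1 : ℝ) := Finset.sum_nonneg (fun _ _ => Nat.cast_nonneg _)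
    linarith
  have key := tail_aux k x b hk hx hb hθ
  set C : ℝ := x ^ k / (x ^ k - 1) with hC
  have hC0 : 0 ≤ C := by positivity
  have hle : ∀ p ∈ s, Real.log p.1 / ((p.1 : ℝ) ^ k - 1)
      ≤ C * ((p.1 : ℝ) ^ (-k) * (if p.1.Prime then Real.log p.1 else 0)) := by
    intro p _
    rw [if_pos p.2.1]
    have hp := p.2.2
    have hp0 : (0 : ℝ) < p.1 := by linarith
    have hlog : 0 ≤ Real.log p.1 := Real.log_nonneg (by linarith)
    have hpk : x ^ k ≤ (p.1 : ℝ) ^ k := Real.rpow_le_rpow hx0.le hp.le (by linarith)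
    have : 1 / ((p.1 : ℝ) ^ k - 1) ≤ C * (p.1 : ℝ) ^ (-k) := by
      rw [Real.rpow_neg hp0.le, hC, ← div_eq_mul_inv, div_div,
        div_le_div_iff₀ (by linarith) (by positivity)]
      nlinarith
    calc _ = 1 / ((p.1 : ℝ) ^ k - 1) * Real.log p.1 := by ring
      _ ≤ C * (p.1 : ℝ) ^ (-k) * Real.log p.1 := mul_le_mul_of_nonneg_right this hlog
      _ = _ := by ring
  have hsub : ∑ p ∈ s, ((p.1 : ℝ) ^ (-k) * (if p.1.Prime then Real.log p.1 else 0))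
      ≤ ∑ n ∈ Finset.Ioc ⌊x⌋₊ ⌊b⌋₊, (n : ℝ) ^ (-k) * (if n.Prime then Real.log n else 0) := by
    refine (Finset.sum_map s (Function.Embedding.subtype _)
      (fun n : ℕ => (n : ℝ) ^ (-k) * (if n.Prime then Real.log n else 0))).symm.le.trans ?_
    apply Finset.sum_le_sum_of_subset_of_nonneg
    · intro n hn
      obtain ⟨p, hp, rfl⟩ := Finset.mem_map.1 hn
      rw [Finset.mem_Ioc]
      refine ⟨(Nat.floor_lt hx0.le).2 p.2.2, Nat.le_floor ?_⟩
      have : (p.1 : ℝ) ≤ ∑ p ∈ s, (p.1 : ℝ) :=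
        Finset.single_le_sum (f := fun p : {p : ℕ // p.Prime ∧ x < (p : ℝ)} => (p.1 : ℝ))
          (fun _ _ => Nat.cast_nonneg _) hp
      show (p.1 : ℝ) ≤ b
      linarith
    · intro n _ _
      apply mul_nonneg (Real.rpow_nonneg (Nat.cast_nonneg _) _)
      split_ifs
      · exact Real.log_natCast_nonneg n
      · exact le_rfl
  calc _ ≤ ∑ p ∈ s, C * ((p.1 : ℝ) ^ (-k) * (if p.1.Prime then Real.log p.1 else 0)) :=
        Finset.sum_le_sum hle
    _ = C * ∑ p ∈ s, ((p.1 : ℝ) ^ (-k) * (if p.1.Prime then Real.log p.1 else 0)) := by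
        rw [Finset.mul_sum]
    _ ≤ C * (x ^ (1 - k) * (-0.98 + 1.017 * k / (k - 1))) :=
        mul_le_mul_of_nonneg_left (hsub.trans key) hC0
    _ = _ := by
        rw [← mul_assoc]
        congr 1
        have : x = x ^ k * x ^ (1 - k) := by
          rw [← Real.rpow_add hx0]; simp
        rw [hC, div_mul_eq_mul_div, ← this]
end

section
/- Let m ≥ 1, let χ be a non-principal Dirichlet character modulo m, and let k ≥ 0 be an integer. Then the k-th derivative of the Dirichlet L-function of χ at s = 1 satisfies L^{(k)}(1,χ) = (−1)^k · ∑_{r=1}^m χ(r)·γ_k(r,m), where γ_k(r,m) := lim_{x→∞} ( ∑_{0 < n ≤ x, n ≡ r (mod m)} (log n)^k/n − (log x)^{k+1}/(m(k+1)) ) is the generalized Euler constant for the arithmetic progression r modulo m. -/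
open Filter Finset Topology

/-- Abel's theorem for Dirichlet series, at `0`. -/
theorem abel_dirichlet (a : ℕ → ℂ) (C : ℂ)
    (hS : ∀ w : ℝ, 0 < w → LSeriesSummable a w)
    (hC : Tendsto (fun N : ℕ => ∑ n ∈ Finset.Icc 1 N, a n) atTop (𝓝 C)) :
    Tendsto (fun w : ℝ => LSeries a w) (𝓝[>] 0) (𝓝 C) := by
  set S : ℕ → ℂ := fun N => ∑ n ∈ Finset.Icc 1 N, a n with hSdef
  obtain ⟨M, hM⟩ : ∃ M, ∀ N, ‖S N‖ ≤ M := by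
    obtain ⟨M, hM⟩ := (Metric.isBounded_range_of_tendsto S hC).exists_norm_le
    exact ⟨M, fun N => hM _ ⟨N, rfl⟩⟩
  have key : ∀ w : ℝ, 0 < w → LSeries a w
      = ∫ y in Set.Ioi (1 : ℝ), (y ^ (-2 : ℝ)) • S ⌊y ^ w⁻¹⌋₊ := by
    intro w hw
    have h1 := LSeries_eq_mul_integral a (le_refl (0 : ℝ)) (s := (w : ℂ)) (by simpa using hw)
      (hS w hw) (by
        refine Asymptotics.IsBigO.of_bound M (Eventually.of_forall fun n => ?_)
        simpa using hM n)
    have h2 := MeasureTheory.integral_comp_rpow_Ioi_of_pos'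
      (g := fun y : ℝ => (y ^ (-2 : ℝ)) • S ⌊y ^ w⁻¹⌋₊) hw (zero_le_one)
    rw [← h2, h1, Real.one_rpow, ← MeasureTheory.integral_const_mul]
    refine MeasureTheory.setIntegral_congr_fun measurableSet_Ioi fun t ht => ?_
    have ht0 : (0 : ℝ) < t := lt_trans one_pos ht
    rw [Real.rpow_rpow_inv ht0.le hw.ne', smul_smul, ← Real.rpow_mul ht0.le, mul_assoc w,
      ← Real.rpow_add ht0, show w - 1 + w * -2 = -(w + 1) by ring, Complex.real_smul]
    push_cast
    rw [Complex.ofReal_cpow ht0.le]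
    push_cast
    ring
  have hval : ∫ y in Set.Ioi (1 : ℝ), (y ^ (-2 : ℝ)) • C = C := by
    rw [integral_smul_const, integral_Ioi_rpow_of_lt (by norm_num) one_pos]
    norm_num
  have hint : Tendsto (fun w : ℝ => ∫ y in Set.Ioi (1 : ℝ), (y ^ (-2 : ℝ)) • S ⌊y ^ w⁻¹⌋₊)
      (𝓝[>] 0) (𝓝 (∫ y in Set.Ioi (1 : ℝ), (y ^ (-2 : ℝ)) • C)) := by
    refine MeasureTheory.tendsto_integral_filter_of_dominated_convergence
      (fun y : ℝ => y ^ (-2 : ℝ) * M) ?_ ?_ ?_ ?_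
    · refine Eventually.of_forall fun w => ?_
      have : Measurable (fun y : ℝ => S ⌊y ^ w⁻¹⌋₊) :=
        (measurable_from_nat (f := S)).comp
          (Nat.measurable_floor.comp (by fun_prop))
      exact ((by fun_prop : Measurable fun y : ℝ => y ^ (-2 : ℝ)).smul this).aestronglyMeasurable
    · refine Eventually.of_forall fun w => ?_
      filter_upwards [MeasureTheory.ae_restrict_mem measurableSet_Ioi] with y hy
      have hy0 : (0 : ℝ) < y := lt_trans one_pos hy
      rw [norm_smul, Real.norm_of_nonneg (by positivity)]
      exact mul_le_mul_of_nonneg_left (hM _) (by positivity)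
    · exact (integrableOn_Ioi_rpow_of_lt (by norm_num) one_pos).mul_const M
    · filter_upwards [MeasureTheory.ae_restrict_mem measurableSet_Ioi] with y hy
      refine Tendsto.const_smul (hC.comp (tendsto_nat_floor_atTop.comp ?_)) _
      exact (tendsto_rpow_atTop_of_base_gt_one y hy).comp tendsto_inv_nhdsGT_zero
  rw [hval] at hint
  refine hint.congr' ?_
  filter_upwards [self_mem_nhdsWithin] with w hw
  exact (key w hw).symm

theorem logMul_iter (f : ℕ → ℂ) (k n : ℕ) :
    (LSeries.logMul^[k] f) n = (Complex.log n) ^ k * f n := by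
  induction k with
  | zero => simp
  | succ k ih =>
    rw [Function.iterate_succ_apply', LSeries.logMul, ih]; ring

theorem term_shift (f : ℕ → ℂ) (k : ℕ) (w : ℝ) :
    LSeries.term (fun n => f n * ((Real.log n ^ k / (n : ℝ) : ℝ) : ℂ)) w
      = LSeries.term (LSeries.logMul^[k] f) (1 + w) := by
  funext n
  rcases eq_or_ne n 0 with rfl | hn
  · simp
  · rw [LSeries.term_of_ne_zero hn, LSeries.term_of_ne_zero hn, logMul_iter,
      Complex.cpow_add _ _ (by exact_mod_cast hn), Complex.cpow_one]
    push_cast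
    have : (n : ℂ) ≠ 0 := by exact_mod_cast hn
    field_simp

theorem sum_char_Icc (m : ℕ) [NeZero m] (F : ZMod m → ℂ) :
    ∑ r ∈ Finset.Icc 1 m, F r = ∑ z, F z := by
  have h0 : 0 < m := Nat.pos_of_ne_zero (NeZero.ne m)
  have h : ∀ z : ZMod m, ∃! r, r ∈ Finset.Icc 1 m ∧ (r : ZMod m) = z := by
    intro z
    by_cases hz : z = 0
    · refine ⟨m, ⟨by simp; omega, by simp [hz]⟩, ?_⟩
      rintro r ⟨hr, hr'⟩
      rw [hz, ZMod.natCast_eq_zero_iff] at hr'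
      rw [Finset.mem_Icc] at hr
      exact le_antisymm hr.2 (Nat.le_of_dvd (by omega) hr')
    · have hv : z.val ≠ 0 := by simpa using hz
      have hlt := z.val_lt
      refine ⟨z.val, ⟨by rw [Finset.mem_Icc]; omega, by simp⟩, ?_⟩
      rintro r ⟨hr, hr'⟩
      rw [Finset.mem_Icc] at hr
      have : r ≠ m := by rintro rfl; simp at hr'; exact hz hr'.symm
      rw [← hr', ZMod.val_natCast, Nat.mod_eq_of_lt (by omega)]
  refine Finset.sum_bij (fun r _ => (r : ZMod m)) (by simp) ?_ ?_ (by simp)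
  · intro r hr s hs hrs
    exact (h (r : ZMod m)).unique ⟨hr, rfl⟩ ⟨hs, hrs.symm⟩
  · intro z _
    obtain ⟨r, hr, -⟩ := h z
    exact ⟨r, hr.1, hr.2⟩

/-- For a non-principal Dirichlet character `χ` mod `m` and `k ≥ 0`,
`L^{(k)}(1,χ) = (-1)^k ∑_{r=1}^m χ(r) γ_k(r,m)`, where the generalized Euler
constants are given by
`γ_k(r,m) = lim_{x→∞} ( ∑_{0<n≤x, n≡r (mod m)} (log n)^k/n − (log x)^{k+1}/(m(k+1)) )`. -/
theorem Lfunction_deriv_eq_sum_euler_constants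
    (m : ℕ) (hm : 1 ≤ m) [NeZero m] (χ : DirichletCharacter ℂ m) (hχ : χ ≠ 1)
    (k : ℕ) (γ : ℕ → ℝ)
    (hγ : ∀ r : ℕ, Tendsto (fun x : ℝ =>
        (∑ n ∈ (Finset.Icc 1 ⌊x⌋₊).filter (fun n => n % m = r % m),
            Real.log n ^ k / (n : ℝ))
          - Real.log x ^ (k + 1) / (m * (k + 1))) atTop (𝓝 (γ r))) :
    iteratedDeriv k (DirichletCharacter.LFunction χ) 1
      = (-1) ^ k * ∑ r ∈ Finset.Icc 1 m, χ r * (γ r : ℂ) := by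
  set a : ℕ → ℂ := fun n => χ n * ((Real.log n ^ k / (n : ℝ) : ℝ) : ℂ) with ha
  have hsum0 : ∑ r ∈ Finset.Icc 1 m, χ (r : ZMod m) = 0 := by
    rw [sum_char_Icc m (fun z => χ z)]
    exact MulChar.sum_eq_zero_of_ne_one hχ
  have hC : Tendsto (fun N : ℕ => ∑ n ∈ Finset.Icc 1 N, a n) atTop
      (𝓝 (∑ r ∈ Finset.Icc 1 m, χ r * (γ r : ℂ))) := by
    have h1 : Tendsto (fun N : ℕ => ∑ r ∈ Finset.Icc 1 m, χ r *
        (((∑ n ∈ (Finset.Icc 1 ⌊(N : ℝ)⌋₊).filter (fun n => n % m = r % m),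
            Real.log n ^ k / (n : ℝ))
          - Real.log (N : ℝ) ^ (k + 1) / (m * (k + 1)) : ℝ) : ℂ)) atTop
      (𝓝 (∑ r ∈ Finset.Icc 1 m, χ r * (γ r : ℂ))) := by
      refine tendsto_finsetSum _ fun r _ => Tendsto.const_mul _ ?_
      exact (Complex.continuous_ofReal.tendsto _).comp
        ((hγ r).comp tendsto_natCast_atTop_atTop)
    refine h1.congr fun N => ?_
    simp only [Complex.ofReal_sub, mul_sub, Finset.sum_sub_distrib, Nat.floor_natCast]
    rw [← Finset.sum_mul, hsum0, zero_mul, sub_zero]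
    simp only [Complex.ofReal_sum, Finset.mul_sum, Finset.sum_filter]
    rw [Finset.sum_comm]
    refine Finset.sum_congr rfl fun n _ => ?_
    have hF := sum_char_Icc m (fun z => if (n : ZMod m) = z then
      χ z * ((Real.log n ^ k / (n : ℝ) : ℝ) : ℂ) else 0)
    rw [Finset.sum_ite_eq, if_pos (Finset.mem_univ _)] at hF
    refine Eq.trans ?_ hF
    refine Finset.sum_congr rfl fun r _ => ?_
    simp only [ZMod.natCast_eq_natCast_iff']
    split_ifs <;> simp
  have habs : LSeries.abscissaOfAbsConv (fun n : ℕ => χ n) ≤ 1 :=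
    LSeries.abscissaOfAbsConv_le_of_forall_lt_LSeriesSummable
      fun y hy => ZMod.LSeriesSummable_of_one_lt_re χ (by simpa using hy)
  have hlt : ∀ w : ℝ, 0 < w →
      LSeries.abscissaOfAbsConv (fun n : ℕ => χ n) < ((1 + w : ℂ).re : EReal) := by
    intro w hw
    refine lt_of_le_of_lt habs ?_
    simp only [Complex.add_re, Complex.one_re, Complex.ofReal_re]
    exact_mod_cast (by linarith : (1 : ℝ) < 1 + w)
  have hAbel := abel_dirichlet a _ (fun w hw => by
    rw [LSeriesSummable, ha, term_shift (fun n : ℕ => χ n)]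
    apply LSeriesSummable_of_abscissaOfAbsConv_lt_re
    rw [LSeries.absicssaOfAbsConv_logPowMul]
    exact hlt w hw) hC
  have hcont : Continuous (iteratedDeriv k (DirichletCharacter.LFunction χ)) :=
    (DirichletCharacter.differentiable_LFunction hχ).contDiff.continuous_iteratedDeriv k
      (le_top (a := (k : WithTop ℕ∞)))
  have h2 : Tendsto (fun w : ℝ => iteratedDeriv k (DirichletCharacter.LFunction χ) (1 + w))
      (𝓝[>] 0) (𝓝 (iteratedDeriv k (DirichletCharacter.LFunction χ) 1)) := by
    have : Continuous (fun w : ℝ =>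
        iteratedDeriv k (DirichletCharacter.LFunction χ) (1 + w)) := by fun_prop
    simpa using (this.tendsto 0).mono_left nhdsWithin_le_nhds
  refine tendsto_nhds_unique h2 ((hAbel.const_mul ((-1) ^ k)).congr' ?_)
  filter_upwards [self_mem_nhdsWithin] with w hw
  have hw : 0 < w := hw
  have heq : DirichletCharacter.LFunction χ =ᶠ[𝓝 (1 + w : ℂ)] LSeries (fun n : ℕ => χ n) := by
    have hopen : IsOpen {s : ℂ | 1 < s.re} := isOpen_lt continuous_const Complex.continuous_re
    filter_upwards [hopen.mem_nhds (show (1 + w : ℂ) ∈ {s : ℂ | 1 < s.re} by simpa using hw)]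
      with s hs
    exact DirichletCharacter.LFunction_eq_LSeries χ hs
  rw [heq.iteratedDeriv_eq, LSeries_iteratedDeriv k (hlt w hw)]
  congr 1
  rw [LSeries, LSeries, ha, term_shift (fun n : ℕ => χ n)]
end

section
/- For every positive integer n, the Ramanujan tau value τ(n) is odd if and only if n is an odd perfect square; consequently, for every real x ≥ 1, the number of positive integers n ≤ x with τ(n) odd equals ⌊(1 + √x)/2⌋. -/
open Finset

/-- Ramanujan's tau function, defined by
`q ∏_{n≥1} (1 - q^n)^24 = ∑_{n≥1} τ(n) q^n`; the coefficient of `q^n` only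
involves the factors with index at most `n`. -/
noncomputable def ramanujanTau (n : ℕ) : ℤ :=
  (Polynomial.X * ∏ k ∈ Finset.Icc 1 n, ((1 : Polynomial ℤ) - Polynomial.X ^ k) ^ 24).coeff n

namespace TauAux

open Polynomial

lemma tele {R : Type*} [CommRing R] (q : R) (n m : ℕ) (h : m ≤ n) :
    ∑ s ∈ range m, (∏ k ∈ range s, (1 - q ^ (2*k+1))) * (∏ k ∈ Ico s n, (1 - q ^ (2*k+2)))
      * q ^ (s*(2*n+1)) * ((1 - q^(2*n+2)) * q^(2*s) - (1 - q^(2*n+1)))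
    = q ^ (m*(2*n+1)) * (∏ k ∈ range m, (1 - q ^ (2*k+1))) *
      (∏ k ∈ Ico m n, (1 - q ^ (2*k+2))) * (1 - q^(2*m)) := by
  induction m with
  | zero => simp
  | succ m ih =>
    rw [sum_range_succ, ih (by omega), prod_range_succ, prod_eq_prod_Ico_succ_bot (by omega : m < n)]
    generalize (∏ k ∈ range m, (1 - q ^ (2*k+1))) = D
    generalize (∏ k ∈ Ico (m+1) n, (1 - q ^ (2*k+2))) = E
    ring

lemma shanks {R : Type*} [CommRing R] (q : R) (n : ℕ) :
    (∏ k ∈ range n, (1 - q ^ (2*k+1))) * ∑ s ∈ range (2*n), q ^ (∑ i ∈ range (s+1), i)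
    = ∑ s ∈ range n, (∏ k ∈ range s, (1 - q ^ (2*k+1))) * (∏ k ∈ Ico s n, (1 - q ^ (2*k+2)))
      * q ^ (s*(2*n+1)) := by
  induction n with
  | zero => simp
  | succ n ih =>
    have ht := tele q n n le_rfl
    have hT : ∑ i ∈ range (2*n+1), i = n*(2*n+1) := by
      have := Finset.sum_range_id_mul_two (2*n+1)
      simp only [Nat.add_sub_cancel] at this
      nlinarith
    have hT2 : ∑ i ∈ range (2*n+1+1), i = n*(2*n+1) + (2*n+1) := by
      rw [sum_range_succ, hT]
    have hsplit : ∑ s ∈ range n, (∏ k ∈ range s, (1 - q ^ (2*k+1))) *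
        (∏ k ∈ Ico s (n+1), (1 - q ^ (2*k+2))) * q ^ (s*(2*(n+1)+1))
        = ∑ s ∈ range n, (∏ k ∈ range s, (1 - q ^ (2*k+1))) * (∏ k ∈ Ico s n, (1 - q ^ (2*k+2)))
      * q ^ (s*(2*n+1)) * ((1 - q^(2*n+2)) * q^(2*s) - (1 - q^(2*n+1)))
        + (1 - q^(2*n+1)) * ∑ s ∈ range n, (∏ k ∈ range s, (1 - q ^ (2*k+1))) *
          (∏ k ∈ Ico s n, (1 - q ^ (2*k+2))) * q ^ (s*(2*n+1)) := by
      rw [mul_sum, ← sum_add_distrib]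
      refine sum_congr rfl fun s hs => ?_
      rw [prod_Ico_succ_top (by have := mem_range.1 hs; omega)]
      ring
    rw [sum_range_succ _ n, hsplit, ht, ← ih, show 2*(n+1) = 2*n+1+1 by ring,
      sum_range_succ _ (2*n+1), sum_range_succ _ (2*n), prod_range_succ, hT, hT2]
    simp only [Ico_self, prod_empty, Nat.Ico_succ_singleton, prod_singleton]
    generalize (∏ k ∈ range n, (1 - q ^ (2*k+1))) = D
    generalize (∑ s ∈ range (2*n), q ^ (∑ i ∈ range (s+1), i)) = S
    ring

noncomputable def phi (n : ℕ) : (ZMod 2)[X] := ∏ k ∈ range n, (1 - X ^ (k+1))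

lemma sq_sub (k : ℕ) : (1 - X ^ k : (ZMod 2)[X])^2 = 1 - X^(2*k) := by
  rw [sub_pow_char, one_pow, ← pow_mul, mul_comm]

lemma phi_sq (n : ℕ) : phi n ^ 2 = ∏ k ∈ range n, (1 - X ^ (2*k+2)) := by
  rw [phi, ← prod_pow]
  exact prod_congr rfl fun k _ => by rw [sq_sub]; congr 1

lemma phi_two (n : ℕ) : (∏ k ∈ range n, (1 - X ^ (2*k+1) : (ZMod 2)[X])) *
    ∏ k ∈ range n, (1 - X ^ (2*k+2)) = phi (2*n) := by
  unfold phi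
  induction n with
  | zero => simp
  | succ n ih =>
    rw [show 2*(n+1) = 2*n+1+1 by ring, prod_range_succ, prod_range_succ, prod_range_succ,
      prod_range_succ, ← ih]
    ring

lemma phi_congr (a b : ℕ) : (X : (ZMod 2)[X]) ^ (a+1) ∣ phi (a+b) - phi a := by
  induction b with
  | zero => simp
  | succ b ih =>
    have : phi (a+(b+1)) - phi a = (phi (a+b) - phi a) - X^(a+1) * (X^b * phi (a+b)) := by
      rw [← add_assoc, phi, prod_range_succ, ← phi]; ring
    rw [this]
    exact dvd_sub ih (dvd_mul_right _ _)

lemma phi_coprime (n m : ℕ) : IsCoprime ((X : (ZMod 2)[X])^m) (phi n) := by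
  apply IsCoprime.pow_left
  apply IsCoprime.prod_right
  intro k _
  exact ⟨X^k, 1, by ring⟩

lemma main_congr (n : ℕ) (hn : 1 ≤ n) : (X : (ZMod 2)[X]) ^ (2*n+1) ∣
    phi (2*n) ^ 3 - ∑ s ∈ range (2*n), X ^ (∑ i ∈ range (s+1), i) := by
  have h1 := shanks (X : (ZMod 2)[X]) n
  set S : (ZMod 2)[X] := ∑ s ∈ range (2*n), X ^ (∑ i ∈ range (s+1), i)
  have h2 : (X : (ZMod 2)[X]) ^ (2*n+1) ∣
      (∏ k ∈ range n, (1 - X ^ (2*k+1))) * S - phi n ^ 2 := by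
    obtain ⟨m, rfl⟩ : ∃ m, n = m+1 := ⟨n-1, by omega⟩
    rw [h1, sum_range_succ', phi_sq]
    simp only [range_zero, prod_empty, one_mul, zero_mul, pow_zero, mul_one, Nat.Ico_zero_eq_range,
      add_sub_cancel_right]
    refine dvd_sum fun s _ => Dvd.dvd.mul_left (pow_dvd_pow _ ?_) _
    nlinarith
  have h3 : (X : (ZMod 2)[X]) ^ (2*n+1) ∣ phi (2*n) * S - phi n ^ 4 := by
    rw [← phi_two, ← phi_sq]
    convert h2.mul_right (phi n ^ 2) using 1
    ring
  have h4 : (X : (ZMod 2)[X]) ^ (2*n+1) ∣ phi (2*n) ^ 4 - phi n ^ 4 := by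
    have h5 := pow_dvd_pow_of_dvd (phi_congr n n) 4
    rw [← two_mul, show (4:ℕ) = 2^2 by rfl, sub_pow_char_pow, ← pow_mul] at h5
    exact (pow_dvd_pow _ (by omega)).trans h5
  refine (phi_coprime (2*n) (2*n+1)).dvd_of_dvd_mul_left ?_
  convert dvd_sub h4 h3 using 1
  ring

open Classical in
lemma tau_cast (n : ℕ) (hn : 1 ≤ n) : ((ramanujanTau n : ℤ) : ZMod 2) =
    if ∃ s, n = (2*s+1)^2 then 1 else 0 := by
  have e1 : ((ramanujanTau n : ℤ) : ZMod 2) = (X * phi n ^ 24 : (ZMod 2)[X]).coeff n := by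
    rw [ramanujanTau, ← eq_intCast (Int.castRingHom (ZMod 2)), ← Polynomial.coeff_map]
    congr 1
    rw [phi, ← prod_pow, range_eq_Ico, Finset.prod_Ico_add' (fun k => (1 - X^k : (ZMod 2)[X])^24)]
    simp [Polynomial.map_prod, Polynomial.map_mul]
    rfl
  have d1 : (X : (ZMod 2)[X]) ^ (n+1) ∣ phi (2*n) ^ 24 - phi n ^ 24 :=
    (two_mul n ▸ phi_congr n n).trans (sub_dvd_pow_sub_pow _ _ _)
  have d2 : (X : (ZMod 2)[X]) ^ (n+1) ∣ phi (2*n) ^ 24 -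
      (∑ s ∈ range (2*n), X ^ (∑ i ∈ range (s+1), i)) ^ 8 := by
    have := (main_congr n hn).trans (sub_dvd_pow_sub_pow _ _ 8)
    rw [← pow_mul] at this
    exact (pow_dvd_pow _ (by omega)).trans this
  have e2 : (∑ s ∈ range (2*n), X ^ (∑ i ∈ range (s+1), i) : (ZMod 2)[X]) ^ 8 =
      ∑ s ∈ range (2*n), X ^ (4*s*(s+1)) := by
    rw [show (8:ℕ) = 2^3 by rfl, sum_pow_char_pow]
    refine sum_congr rfl fun s _ => ?_
    rw [← pow_mul]
    congr 1
    have := Finset.sum_range_id_mul_two (s+1)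
    simp only [Nat.add_sub_cancel] at this
    nlinarith
  rw [e2] at d2
  have d3 : (X : (ZMod 2)[X]) ^ (n+1) ∣ X * phi n ^ 24 - X * ∑ s ∈ range (2*n), X ^ (4*s*(s+1)) := by
    convert (dvd_sub d2 d1).mul_left X using 1
    ring
  have d4 := (Polynomial.X_pow_dvd_iff.1 d3) n (by omega)
  rw [coeff_sub, sub_eq_zero] at d4
  rw [e1, d4, mul_sum, finsetSum_coeff]
  have e3 : ∀ s, (X * X ^ (4*s*(s+1)) : (ZMod 2)[X]).coeff n = if n = (2*s+1)^2 then 1 else 0 := by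
    intro s
    rw [← pow_succ', coeff_X_pow]
    congr 2
    ring
  simp only [e3]
  split_ifs with h
  · obtain ⟨s, hs⟩ := h
    rw [sum_eq_single s]
    · simp [hs]
    · intro t _ hts
      rw [if_neg]
      intro h
      rw [hs] at h
      have := Nat.pow_left_injective (n := 2) (by norm_num) h
      omega
    · intro hh
      exfalso; apply hh; rw [mem_range]; nlinarith
  · push Not at h
    exact sum_eq_zero fun s _ => if_neg (h s)

lemma tau_odd (n : ℕ) (hn : 1 ≤ n) : Odd (ramanujanTau n) ↔ ∃ s, n = (2*s+1)^2 := by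
  rw [← Int.not_even_iff_odd, even_iff_two_dvd]
  have := ZMod.intCast_zmod_eq_zero_iff_dvd (ramanujanTau n) 2
  rw [tau_cast n hn] at this
  push_cast at this
  rw [← this]
  split_ifs with h <;> simp [h]

end TauAux

/-- `τ(n)` is odd exactly when `n` is an odd square; consequently the number of
`n ≤ x` with `τ(n)` odd equals `⌊(1 + √x)/2⌋`. -/
theorem tau_odd_iff_odd_square_and_count :
    (∀ n : ℕ, 1 ≤ n → (Odd (ramanujanTau n) ↔ Odd n ∧ ∃ m : ℕ, n = m ^ 2)) ∧
    ∀ x : ℝ, 1 ≤ x →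
      (((Finset.Icc 1 ⌊x⌋₊).filter (fun n => Odd (ramanujanTau n))).card : ℝ)
        = ⌊(1 + Real.sqrt x) / 2⌋₊ := by
  refine ⟨fun n hn => ?_, fun x hx => ?_⟩
  · rw [TauAux.tau_odd n hn]
    constructor
    · rintro ⟨s, rfl⟩
      exact ⟨Odd.pow ⟨s, rfl⟩, _, rfl⟩
    · rintro ⟨ho, m, rfl⟩
      obtain ⟨s, rfl⟩ := (Nat.odd_pow_iff (by norm_num)).1 ho
      exact ⟨s, rfl⟩
  · have key : (Finset.Icc 1 ⌊x⌋₊).filter (fun n => Odd (ramanujanTau n)) =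
        (range ⌊(1 + Real.sqrt x) / 2⌋₊).image (fun s => (2*s+1)^2) := by
      have hs : ∀ s : ℕ, s < ⌊(1 + Real.sqrt x) / 2⌋₊ ↔ (2*s+1)^2 ≤ ⌊x⌋₊ := by
        intro s
        rw [← Nat.succ_le_iff, Nat.le_floor_iff (by positivity), Nat.le_floor_iff (by linarith)]
        push_cast
        rw [← Real.le_sqrt (by positivity) (by linarith)]
        constructor <;> intro h <;> linarith
      ext n
      simp only [mem_filter, mem_Icc, mem_image, mem_range]
      constructor
      · rintro ⟨⟨h1, h2⟩, h3⟩
        obtain ⟨s, rfl⟩ := (TauAux.tau_odd n h1).1 h3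
        exact ⟨s, (hs s).2 h2, rfl⟩
      · rintro ⟨s, h, rfl⟩
        have h1 : 1 ≤ (2*s+1)^2 := Nat.one_le_pow _ _ (by omega)
        exact ⟨⟨h1, (hs s).1 h⟩, (TauAux.tau_odd _ h1).2 ⟨s, rfl⟩⟩
    rw [key, card_image_of_injective, card_range]
    intro a b h
    have := Nat.pow_left_injective (n := 2) (by norm_num) h
    omega
end

section
/- For every positive integer n, τ(n) ≡ n·σ₁(n) (mod 5), where σ₁(n) = ∑_{d | n} d is the sum-of-divisors function. -/
open Finset

namespace TauFive

open Polynomial in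
/-- partial products -/
noncomputable def A (s : Finset ℕ) : Polynomial ℤ :=
  X * ∏ i ∈ s, ((1 : Polynomial ℤ) - X ^ (i + 1)) ^ 24

open Polynomial in
lemma dvd_prod_sub_one (m : ℕ) (t : Finset ℕ) (f : ℕ → Polynomial ℤ)
    (h : ∀ i ∈ t, (X : Polynomial ℤ) ^ m ∣ f i - 1) : (X : Polynomial ℤ) ^ m ∣ (∏ i ∈ t, f i) - 1 := by
  refine Finset.prod_induction f (fun p => (X : Polynomial ℤ) ^ m ∣ p - 1) ?_ (by simp) h
  intro a b ha hb
  have : a * b - 1 = (a - 1) * b + (b - 1) := by ring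
  rw [this]
  exact dvd_add (ha.mul_right _) hb

open Polynomial in
lemma A_coeff (n : ℕ) (s : Finset ℕ) (hs : Finset.range n ⊆ s) :
    (A s).coeff n = ramanujanTau n := by
  have h0 : ramanujanTau n = (A (Finset.range n)).coeff n := by
    have e : ∀ f : ℕ → Polynomial ℤ, ∏ k ∈ Finset.Icc 1 n, f k =
        ∏ i ∈ Finset.range n, f (i + 1) := by
      intro f
      rw [← Finset.Ico_add_one_right_eq_Icc, Finset.prod_Ico_eq_prod_range]
      simp only [add_comm 1, Nat.add_sub_cancel]
    unfold ramanujanTau A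
    rw [e]
  rw [h0]
  have h1 : A s = A (Finset.range n) * ∏ i ∈ s \ Finset.range n, (1 - X ^ (i + 1)) ^ 24 := by
    unfold A
    rw [mul_assoc, mul_comm (∏ i ∈ Finset.range n, _), Finset.prod_sdiff hs]
  obtain ⟨c, hc⟩ := dvd_prod_sub_one (n + 1) (s \ Finset.range n)
    (fun i => (1 - X ^ (i + 1)) ^ 24) (by
      intro i hi
      have hi' : n ≤ i := by simpa using (Finset.mem_sdiff.1 hi).2
      have h2 : ((1 : Polynomial ℤ) - X ^ (i + 1)) - 1 ∣ (1 - X ^ (i + 1)) ^ 24 - 1 ^ 24 :=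
        sub_dvd_pow_sub_pow _ _ _
      rw [one_pow] at h2
      refine dvd_trans ?_ h2
      rw [show ((1 : Polynomial ℤ) - X ^ (i + 1)) - 1 = - X ^ (i + 1) by ring, dvd_neg]
      exact pow_dvd_pow _ (by omega))
  have h3 : A s = A (Finset.range n) + X ^ (n + 1) * (A (Finset.range n) * c) := by
    rw [h1, eq_add_of_sub_eq hc]; ring
  rw [h3, coeff_add, coeff_X_pow_mul']
  simp

/-- tau generating series -/
noncomputable def D : PowerSeries ℤ := PowerSeries.mk ramanujanTau

noncomputable def P : PowerSeries ℤ :=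
  PowerSeries.mk fun n => if n = 0 then 1 else -24 * (ArithmeticFunction.sigma 1 n : ℤ)
noncomputable def Q : PowerSeries ℤ :=
  PowerSeries.mk fun n => if n = 0 then 1 else 240 * (ArithmeticFunction.sigma 3 n : ℤ)
noncomputable def R : PowerSeries ℤ :=
  PowerSeries.mk fun n => if n = 0 then 1 else -504 * (ArithmeticFunction.sigma 5 n : ℤ)

open PowerSeries in
noncomputable def g (k : ℕ) : PowerSeries ℤ :=
  PowerSeries.mk fun n => if n ≠ 0 ∧ (k + 1) ∣ n then 1 else 0

open PowerSeries in
lemma g_spec (k : ℕ) : (1 - (X : PowerSeries ℤ) ^ (k + 1)) * g k = X ^ (k + 1) := by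
  ext n
  rw [sub_mul, one_mul, map_sub, coeff_X_pow_mul', coeff_X_pow]
  simp only [g, coeff_mk]
  rcases lt_trichotomy n (k + 1) with h | h | h
  · have : ¬ (n ≠ 0 ∧ k + 1 ∣ n) := by
      rintro ⟨h1, h2⟩
      have := Nat.le_of_dvd (by omega) h2
      omega
    rw [if_neg this, if_neg (by omega), if_neg (by omega)]; simp
  · subst h; simp
  · have e : (k + 1 ∣ n - (k + 1)) ↔ (k + 1 ∣ n) := by
      rw [Nat.dvd_sub_iff_left h.le dvd_rfl]
    have h4 : n - (k + 1) ≠ 0 := by omega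
    have h5 : n ≠ 0 := by omega
    rw [if_pos h.le, if_neg h.ne']
    simp [e, h4, h5]

open PowerSeries in
/-- Euler operator -/
noncomputable def th {K : Type*} [CommRing K] (f : PowerSeries K) : PowerSeries K := X * derivative K f

open PowerSeries in
lemma th_mul {K : Type*} [CommRing K] (a b : PowerSeries K) : th (a * b) = th a * b + a * th b := by
  simp only [th, Derivation.leibniz, smul_eq_mul]; ring

open PowerSeries in
lemma coeff_th {K : Type*} [CommRing K] (a : PowerSeries K) (n : ℕ) :
    coeff n (th a) = n * coeff n a := by
  cases n with
  | zero => simp [th]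
  | succ n => rw [th, coeff_succ_X_mul, coeff_derivative]; push_cast; ring

open PowerSeries in
lemma th_A (s : Finset ℕ) : th (A s : PowerSeries ℤ) =
    (A s : PowerSeries ℤ) * (1 - 24 * ∑ i ∈ s, ((i : PowerSeries ℤ) + 1) * g i) := by
  induction s using Finset.induction_on with
  | empty => simp [A, th]
  | insert i s hi ih =>
    have h1 : (A (insert i s) : PowerSeries ℤ) = (1 - X ^ (i + 1)) ^ 24 * (A s : PowerSeries ℤ) := by
      simp only [A, Finset.prod_insert hi]
      push_cast
      ring
    have h2 : th ((1 - (X : PowerSeries ℤ) ^ (i + 1)) ^ 24) =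
        (1 - (X : PowerSeries ℤ) ^ (i + 1)) ^ 24 * (-24 * ((i : PowerSeries ℤ) + 1) * g i) := by
      have : th ((1 - (X : PowerSeries ℤ) ^ (i + 1)) ^ 24) =
          -24 * (1 - (X : PowerSeries ℤ) ^ (i + 1)) ^ 23 * ((i : PowerSeries ℤ) + 1) * X ^ (i + 1) := by
        rw [th, derivative_pow, map_sub, derivative_pow, derivative_X]
        simp only [derivative_one, zero_sub, Nat.cast_ofNat, Nat.cast_add, Nat.cast_one,
          Nat.add_sub_cancel, mul_one, show 24 - 1 = 23 from rfl]
        ring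
      rw [this]
      nth_rewrite 2 [← g_spec i]
      ring
    rw [h1, th_mul, h2, ih, Finset.sum_insert hi]
    ring

open PowerSeries in
lemma th_D : th D = D * P := by
  ext n
  have h := congrArg (coeff n) (th_A (Finset.range n))
  have hA : ∀ m ≤ n, (A (Finset.range n)).coeff m = ramanujanTau m := fun m hm =>
    A_coeff m _ (by simpa using hm)
  rw [coeff_th, Polynomial.coeff_coe, hA n le_rfl] at h
  rw [coeff_th, D, coeff_mk, h, coeff_mul, coeff_mul]
  refine Finset.sum_congr rfl fun x hx => ?_
  have hx' : x.1 + x.2 = n := by simpa using hx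
  rw [Polynomial.coeff_coe, hA _ (by omega), coeff_mk]
  congr 1
  have e : (24 * ∑ i ∈ Finset.range n, ((i : PowerSeries ℤ) + 1) * g i) =
      ∑ i ∈ Finset.range n, C (24 * ((i : ℤ) + 1)) * g i := by
    rw [Finset.mul_sum]
    refine Finset.sum_congr rfl fun i _ => ?_
    simp [mul_assoc]
  rw [e, map_sub, map_sum, P, coeff_mk, coeff_one]
  simp only [coeff_C_mul, g, coeff_mk]
  by_cases h0 : x.2 = 0
  · simp [h0]
  · simp only [h0, if_false, ne_eq, not_false_eq_true, true_and, zero_sub]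
    rw [ArithmeticFunction.sigma_one_apply]
    have : ∑ d ∈ x.2.divisors, d = ∑ i ∈ Finset.range n, if i + 1 ∣ x.2 then i + 1 else 0 := by
      rw [← Finset.sum_filter]
      refine Finset.sum_nbij' (fun d => d - 1) (fun i => i + 1) ?_ ?_ ?_ ?_ ?_
      · intro d hd
        have h1 := Nat.pos_of_mem_divisors hd
        have h2 := Nat.divisor_le hd
        have h3 := Nat.dvd_of_mem_divisors hd
        simp only [Finset.mem_filter, Finset.mem_range, Nat.sub_add_cancel h1]
        exact ⟨by omega, h3⟩
      · intro i hi
        exact Nat.mem_divisors.2 ⟨(Finset.mem_filter.1 hi).2, h0⟩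
      · intro d hd
        exact Nat.sub_add_cancel (Nat.pos_of_mem_divisors hd)
      · intro i hi
        simp
      · intro d hd
        exact (Nat.sub_add_cancel (Nat.pos_of_mem_divisors hd)).symm
    rw [this]
    push_cast
    rw [Finset.mul_sum, ← Finset.sum_neg_distrib]
    refine Finset.sum_congr rfl fun i _ => ?_
    split_ifs <;> ring

section analytic
open UpperHalfPlane ModularForm ModularFormClass MatrixGroups EisensteinSeries Filter Topology

lemma unif (m : ℕ) : TendstoLocallyUniformlyOn
    (fun (s : Finset ℕ) (q : ℂ) => (∏ i ∈ s, (1 - q ^ (i + 1))) ^ m)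
    (fun q => (∏' i, (1 - q ^ (i + 1))) ^ m) atTop (Metric.ball (0 : ℂ) 1) := by
  have h1 : TendstoLocallyUniformlyOn
    (fun (s : Finset ℕ) (q : ℂ) => (∏ i ∈ s, (1 - q ^ (i + 1))))
    (fun q => (∏' i, (1 - q ^ (i + 1)))) atTop (Metric.ball (0 : ℂ) 1) := by
    have := multipliableLocallyUniformlyOn_one_sub_pow.hasProdLocallyUniformlyOn
    rw [hasProdLocallyUniformlyOn_iff_tendstoLocallyUniformlyOn] at this
    exact this
  have hc := differentiableOn_tprod_one_sub_pow.continuousOn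
  induction m with
  | zero =>
    simp only [pow_zero]
    intro u hu x hx
    exact ⟨Set.univ, Filter.univ_mem, by simp [refl_mem_uniformity hu]⟩
  | succ m ih =>
    simp only [pow_succ]
    exact ih.fun_mul₀ h1 (hc.pow m) hc

lemma unif' : TendstoLocallyUniformlyOn
    (fun (s : Finset ℕ) (q : ℂ) => ((A s).map (Int.castRingHom ℂ)).eval q)
    (cuspFunction 1 ModularForm.discriminant) atTop (Metric.ball (0 : ℂ) 1) := by
  have hid : TendstoLocallyUniformlyOn
    (fun (_ : Finset ℕ) (q : ℂ) => q) (fun q => q) atTop (Metric.ball (0 : ℂ) 1) := by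
    intro u hu x hx
    exact ⟨Set.univ, Filter.univ_mem, by simp [refl_mem_uniformity hu]⟩
  have h := hid.fun_mul₀ (unif 24) continuousOn_id
    (differentiableOn_tprod_one_sub_pow.continuousOn.pow 24)
  have h2 : (fun (s : Finset ℕ) (q : ℂ) => ((A s).map (Int.castRingHom ℂ)).eval q) =
      fun s q => q * (∏ i ∈ s, (1 - q ^ (i + 1))) ^ 24 := by
    ext s q
    simp [A, Polynomial.eval_prod, Polynomial.map_prod, Finset.prod_pow]
  rw [h2]
  refine h.congr_right ?_
  intro q hq
  rw [discriminant_cuspFunction_eqOn hq]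
  simp only
  rw [(multipliable_one_sub_pow (by simpa using hq)).tprod_pow]

lemma iter_poly (p : Polynomial ℂ) (n : ℕ) :
    deriv^[n] (fun q => p.eval q) = fun q => (Polynomial.derivative^[n] p).eval q := by
  induction n generalizing p with
  | zero => rfl
  | succ n ih =>
    rw [Function.iterate_succ_apply, Function.iterate_succ_apply, ← ih]
    congr 1
    ext q
    simp

lemma unif_deriv (n : ℕ) : TendstoLocallyUniformlyOn
    (fun (s : Finset ℕ) (q : ℂ) =>
      (Polynomial.derivative^[n] ((A s).map (Int.castRingHom ℂ))).eval q)
    (deriv^[n] (cuspFunction 1 ModularForm.discriminant)) atTop (Metric.ball (0 : ℂ) 1) := by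
  induction n with
  | zero => exact unif'
  | succ n ih =>
    have := ih.deriv (.of_forall fun s => (Polynomial.differentiable _).differentiableOn)
      Metric.isOpen_ball
    rw [Function.iterate_succ_apply']
    convert this using 1
    ext s q
    simp [Function.iterate_succ_apply']

lemma coeff_disc (n : ℕ) :
    (qExpansion 1 ModularForm.discriminant).coeff n = (ramanujanTau n : ℂ) := by
  have h := (unif_deriv n).tendsto_at (Metric.mem_ball_self one_pos : (0 : ℂ) ∈ Metric.ball 0 1)
  have h2 : Tendsto (fun (s : Finset ℕ) =>
      (Polynomial.derivative^[n] ((A s).map (Int.castRingHom ℂ))).eval (0 : ℂ)) atTop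
      (𝓝 ((n.factorial : ℂ) * ramanujanTau n)) := by
    refine tendsto_const_nhds.congr' ?_
    filter_upwards [eventually_ge_atTop (Finset.range n)] with s hs
    rw [← Polynomial.coeff_zero_eq_eval_zero, Polynomial.coeff_iterate_derivative]
    simp [A_coeff n s hs, Nat.descFactorial_self]
  have h3 := tendsto_nhds_unique h h2
  rw [qExpansion_coeff, iteratedDeriv_eq_iterate, h3]
  field_simp [Nat.factorial_ne_zero]

lemma map_D : D.map (Int.castRingHom ℂ) = qExpansion 1 ModularForm.discriminant := by
  ext n
  simp [D, coeff_disc]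

lemma map_Q : Q.map (Int.castRingHom ℂ) = qExpansion 1 E₄ := by
  ext n
  have h1 := E₄_qExpansion_coeff_one
  rw [E_qExpansion_coeff _ ⟨2, rfl⟩] at h1 ⊢
  simp at h1
  by_cases h : n = 0
  · simp [Q, h]
  · simp [Q, h, ← h1]

lemma map_R : R.map (Int.castRingHom ℂ) = qExpansion 1 E₆ := by
  ext n
  have h1 := E₆_qExpansion_coeff_one
  rw [E_qExpansion_coeff _ ⟨3, rfl⟩] at h1 ⊢
  simp at h1
  by_cases h : n = 0
  · simp [R, h]
  · simp [R, h, ← h1]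

lemma disc_id : 1728 * qExpansion 1 ModularForm.discriminant =
    (qExpansion 1 E₄) ^ 3 - (qExpansion 1 E₆) ^ 2 := by
  have hf : (1728 : ℂ) • (CuspForm.discriminant : ℍ → ℂ) =
     (E₄.pow 3 : ℍ → ℂ) - (E₆.pow 2 : ℍ → ℂ) := by
    ext z
    simp only [ModularForm.coe_pow, Pi.smul_apply, Pi.sub_apply, Pi.pow_apply, CuspForm.coe_discriminant,
      discriminant_eq_E₄_cube_sub_E₆_sq z, smul_eq_mul]
    ring
  have h4 := ModularForm.qExpansion_smul one_pos one_mem_strictPeriods_SL 1728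
      CuspForm.discriminant
  rw [hf, ModularForm.qExpansion_sub one_pos one_mem_strictPeriods_SL,
    ModularForm.qExpansion_pow one_pos one_mem_strictPeriods_SL,
    ModularForm.qExpansion_pow one_pos one_mem_strictPeriods_SL] at h4
  rw [h4, CuspForm.coe_discriminant, PowerSeries.smul_eq_C_mul, map_ofNat PowerSeries.C 1728]

lemma int_id : 1728 * D = Q ^ 3 - R ^ 2 := by
  apply PowerSeries.map_injective (Int.castRingHom ℂ) Int.cast_injective
  simp only [map_mul, map_sub, map_pow, map_D, map_Q, map_R, ← disc_id]
  rw [map_ofNat (PowerSeries.map (Int.castRingHom ℂ)) 1728]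

end analytic

open PowerSeries in
lemma final : D.map (Int.castRingHom (ZMod 5)) = th (P.map (Int.castRingHom (ZMod 5))) := by
  set φ := PowerSeries.map (Int.castRingHom (ZMod 5)) with hφ
  have c5 : (5 : PowerSeries (ZMod 5)) = 0 := by
    have : (5 : ZMod 5) = 0 := by decide
    have h := congrArg (C : ZMod 5 → PowerSeries (ZMod 5)) this
    rwa [map_ofNat C 5, map_zero] at h
  have hQ : φ Q = 1 := by
    ext n
    rw [hφ, PowerSeries.coeff_map, Q, coeff_mk, coeff_one]
    have : (240 : ZMod 5) = 0 := by decide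
    split_ifs <;> simp [this]
  have hR : φ R = φ P := by
    ext n
    rw [hφ, PowerSeries.coeff_map, PowerSeries.coeff_map, R, P, coeff_mk, coeff_mk]
    split_ifs
    · rfl
    · have : (504 : ZMod 5) = 24 := by decide
      have h5 : ∀ d : ZMod 5, d ^ 5 = d := by decide
      simp [this, ArithmeticFunction.sigma_apply, h5]
  have hD : φ D * 1728 = 1 - φ P ^ 2 := by
    have := congrArg φ int_id
    simp only [map_mul, map_sub, map_pow, hQ, hR] at this
    rw [map_ofNat φ 1728, one_pow] at this
    rw [mul_comm, this]
  have hth : th (φ D) = φ D * φ P := by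
    rw [← map_mul, ← th_D]
    ext n
    rw [coeff_th, hφ, PowerSeries.coeff_map, PowerSeries.coeff_map, coeff_th]
    simp
  have h1 := congrArg th hD
  have t0 : ∀ k : ℕ, th (k : PowerSeries (ZMod 5)) = 0 := by intro k; simp [th]
  have t1 : th (1 : PowerSeries (ZMod 5)) = 0 := by simp [th]
  have t2 : th (1728 : PowerSeries (ZMod 5)) = 0 := by exact_mod_cast t0 1728
  have t3 : ∀ a b : PowerSeries (ZMod 5), th (a - b) = th a - th b := by
    intro a b; simp [th, mul_sub]
  rw [th_mul, t3, t1, t2, pow_two, th_mul, hth] at h1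
  have hP : φ P ≠ 0 := by
    intro h
    have := congrArg (coeff 0) h
    rw [hφ, PowerSeries.coeff_map, P, coeff_mk] at this
    simp at this
    exact absurd this (by decide)
  have : Fact (Nat.Prime 5) := ⟨by norm_num⟩
  apply mul_left_cancel₀ hP
  linear_combination 2 * h1 - c5 * (φ P * φ D * 691 + φ P * th (φ P))

end TauFive

/-- `τ(n) ≡ n σ₁(n) (mod 5)`. -/
theorem tau_congruent_mod_five (n : ℕ) (hn : 1 ≤ n) :
    ramanujanTau n ≡ (n : ℤ) * (ArithmeticFunction.sigma 1 n : ℤ) [ZMOD 5] := by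
  have h := congrArg (PowerSeries.coeff n) TauFive.final
  rw [TauFive.coeff_th, PowerSeries.coeff_map, PowerSeries.coeff_map, TauFive.D, TauFive.P,
    PowerSeries.coeff_mk, PowerSeries.coeff_mk, if_neg (by omega)] at h
  have : (24 : ZMod 5) = -1 := by decide
  apply (ZMod.intCast_eq_intCast_iff _ _ 5).1
  simpa [this] using h
end

section
/- Define t_n = 1 if 5 ∤ τ(n) and t_n = 0 otherwise, and let T(s) = ∑_{n=1}^∞ t_n·n^{-s}. Then for real s > 1, T(s) = ∏_{p ≡ 1 (mod 5)} (1 − p^{-4s})/((1 − p^{-s})(1 − p^{-5s})) · ∏_{p ≡ ±2 (mod 5)} (1 − p^{-3s})/((1 − p^{-s})(1 − p^{-4s})) · ∏_{p ≡ 4 (mod 5)} (1 − p^{-2s})^{-1}, where all products run over primes in the indicated residue classes. -/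
open Finset

/-- `t n = 1` if `5 ∤ τ(n)`, and `t n = 0` otherwise. -/
noncomputable def t5 (n : ℕ) : ℝ := if (5 : ℤ) ∣ ramanujanTau n then 0 else 1


noncomputable def tauPoly (N : ℕ) : Polynomial ℤ :=
  Polynomial.X * ∏ k ∈ Finset.Icc 1 N, ((1 : Polynomial ℤ) - Polynomial.X ^ k) ^ 24

lemma tauPoly_succ (N : ℕ) :
    tauPoly (N + 1) = tauPoly N * ((1 : Polynomial ℤ) - Polynomial.X ^ (N + 1)) ^ 24 := by
  unfold tauPoly
  rw [Finset.prod_Icc_succ_top (by omega)]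
  ring

lemma tauPoly_coeff {n N : ℕ} (h : n ≤ N) : (tauPoly N).coeff n = ramanujanTau n := by
  induction N, h using Nat.le_induction with
  | base => rfl
  | succ N hN ih =>
    rw [tauPoly_succ, ← ih]
    have h1 : (Polynomial.X ^ (N + 1) : Polynomial ℤ) ∣
        (1 - Polynomial.X ^ (N + 1)) ^ 24 - 1 := by
      have := sub_dvd_pow_sub_pow ((1 : Polynomial ℤ) - Polynomial.X ^ (N + 1)) 1 24
      simpa using this
    obtain ⟨R, hR⟩ := h1
    have h2 : ((1 : Polynomial ℤ) - Polynomial.X ^ (N + 1)) ^ 24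
        = 1 + Polynomial.X ^ (N + 1) * R := by rw [← hR]; ring
    rw [h2, mul_add, mul_one, Polynomial.coeff_add,
      show tauPoly N * (Polynomial.X ^ (N + 1) * R) = (tauPoly N * R) * Polynomial.X ^ (N + 1) by
        ring, Polynomial.coeff_mul_X_pow']
    simp; omega

lemma iteratedDeriv_poly (p : Polynomial ℂ) (m : ℕ) :
    iteratedDeriv m (fun q : ℂ => p.eval q) 0 = (m.factorial : ℂ) * p.coeff m := by
  have : ∀ p : Polynomial ℂ, iteratedDeriv m (fun q : ℂ => p.eval q)
      = fun q => (Polynomial.derivative^[m] p).eval q := by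
    induction m with
    | zero => intro p; simp
    | succ m ih =>
      intro p
      rw [iteratedDeriv_succ', Function.iterate_succ_apply, ← ih]
      congr 1
      ext q
      simp
  rw [this]
  simp only
  rw [← Polynomial.coeff_zero_eq_eval_zero, Polynomial.coeff_iterate_derivative]
  simp [Nat.descFactorial_self]

lemma tlu_iteratedDeriv {F : ℕ → ℂ → ℂ} {f : ℂ → ℂ} {U : Set ℂ} (hU : IsOpen U)
    (hF : ∀ n, Differentiable ℂ (F n))
    (h : TendstoLocallyUniformlyOn F f Filter.atTop U) (m : ℕ) :
    TendstoLocallyUniformlyOn (fun n => iteratedDeriv m (F n)) (iteratedDeriv m f)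
      Filter.atTop U := by
  induction m with
  | zero => simpa using h
  | succ m ih =>
    simp_rw [iteratedDeriv_succ]
    refine TendstoLocallyUniformlyOn.deriv ih ?_ hU
    refine Filter.Eventually.of_forall fun n => ?_
    have h1 : ContDiff ℂ ⊤ (F n) := (hF n).contDiff
    exact (h1.differentiable_iteratedDeriv m (by exact_mod_cast WithTop.coe_lt_top _)).differentiableOn

lemma tlu_tau : TendstoLocallyUniformlyOn
    (fun N q => ((tauPoly N).map (Int.castRingHom ℂ)).eval q)
    (UpperHalfPlane.cuspFunction 1 ModularForm.discriminant) Filter.atTop (Metric.ball (0 : ℂ) 1) := by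
  have h0 := ModularForm.multipliableLocallyUniformlyOn_one_sub_pow.hasProdLocallyUniformlyOn
  have h1 : TendstoLocallyUniformlyOn (fun N q => ∏ i ∈ Finset.range N, (1 - q ^ (i + 1)))
      (fun q : ℂ ↦ ∏' n, (1 - q ^ (n + 1))) Filter.atTop (Metric.ball (0 : ℂ) 1) := by
    intro u hu x hx
    obtain ⟨t, ht, h⟩ := h0 u hu x hx
    exact ⟨t, ht, Filter.tendsto_finset_range.eventually h⟩
  have hc := ModularForm.differentiableOn_tprod_one_sub_pow.continuousOn
  have h2 : ∀ k : ℕ, TendstoLocallyUniformlyOn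
      (fun N q => (∏ i ∈ Finset.range N, (1 - q ^ (i + 1))) ^ k)
      (fun q : ℂ ↦ (∏' n, (1 - q ^ (n + 1))) ^ k) Filter.atTop (Metric.ball (0 : ℂ) 1) := by
    intro k
    induction k with
    | zero =>
      simp only [pow_zero]
      intro u hu x hx
      exact ⟨Set.univ, Filter.univ_mem, Filter.Eventually.of_forall fun _ _ _ => refl_mem_uniformity hu⟩
    | succ k ih =>
      simp only [pow_succ]
      exact TendstoLocallyUniformlyOn.mul₀ ih h1 (hc.pow k) hc
  have h3 : TendstoLocallyUniformlyOn (fun (_ : ℕ) (q : ℂ) => q) (fun q => q) Filter.atTop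
      (Metric.ball (0 : ℂ) 1) := by
    intro u hu x hx
    exact ⟨Set.univ, Filter.univ_mem, Filter.Eventually.of_forall fun _ _ _ => refl_mem_uniformity hu⟩
  have h4 := TendstoLocallyUniformlyOn.mul₀ h3 (h2 24) continuousOn_id (hc.pow 24)
  refine (h4.congr_right ?_).congr ?_
  · intro q hq
    rw [ModularForm.discriminant_cuspFunction_eqOn hq]
    have hm := (ModularForm.multipliable_one_sub_pow (q := q) (by simpa using hq)).tprod_pow 24
    simp [hm]
  · intro N q hq
    simp only [tauPoly, Pi.mul_apply, Polynomial.map_mul, Polynomial.map_X, Polynomial.map_prod,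
      Polynomial.map_pow, Polynomial.map_sub, Polynomial.map_one, Polynomial.eval_mul,
      Polynomial.eval_X, Polynomial.eval_prod, Polynomial.eval_pow, Polynomial.eval_sub,
      Polynomial.eval_one, Finset.prod_pow]
    congr 2
    rw [Finset.range_eq_Ico, Finset.prod_Ico_add' (fun i => 1 - q ^ i) 0 N 1]
    rfl

lemma qExpansion_delta (m : ℕ) :
    (UpperHalfPlane.qExpansion 1 ModularForm.discriminant).coeff m = (ramanujanTau m : ℂ) := by
  rw [UpperHalfPlane.qExpansion_coeff]
  have h := (tlu_iteratedDeriv Metric.isOpen_ball (fun N => by fun_prop) tlu_tau m).tendsto_at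
    (Metric.mem_ball_self one_pos)
  simp_rw [iteratedDeriv_poly] at h
  have h2 := tendsto_nhds_unique h (tendsto_const_nhds.congr' (f₁ := fun _ =>
    (m.factorial : ℂ) * ramanujanTau m) (by
      filter_upwards [Filter.eventually_ge_atTop m] with N hN
      simp [tauPoly_coeff hN]))
  rw [h2]
  field_simp [Nat.factorial_ne_zero]

open EisensteinSeries ModularForm UpperHalfPlane in
lemma delta_id : (1728 : ℂ) • qExpansion 1 ModularForm.discriminant
    = qExpansion 1 E₄ ^ 3 - qExpansion 1 E₆ ^ 2 := by
  have h1 : ((1728 : ℂ) • (CuspForm.discriminant : ℍ → ℂ))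
      = (E₄.pow 3 : ℍ → ℂ) - (E₆.pow 2 : ℍ → ℂ) := by
    ext z
    have := discriminant_eq_E₄_cube_sub_E₆_sq z
    simp only [CuspForm.coe_discriminant, Pi.smul_apply, smul_eq_mul, Pi.sub_apply, ModularForm.coe_pow,
      Pi.pow_apply, this]
    ring
  have h2 := congrArg (qExpansion 1) h1
  rw [ModularForm.qExpansion_sub one_pos one_mem_strictPeriods_SL,
    ModularForm.qExpansion_smul one_pos one_mem_strictPeriods_SL,
    ModularForm.qExpansion_pow one_pos one_mem_strictPeriods_SL,
    ModularForm.qExpansion_pow one_pos one_mem_strictPeriods_SL] at h2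
  exact h2

noncomputable def sigSer (R : Type) [CommRing R] (k : ℕ) : PowerSeries R :=
  PowerSeries.mk fun n => ((ArithmeticFunction.sigma k n : ℕ) : R)

noncomputable def tauSer (R : Type) [CommRing R] : PowerSeries R :=
  PowerSeries.mk fun n => ((ramanujanTau n : ℤ) : R)

open EisensteinSeries ModularForm UpperHalfPlane in
lemma e4_ser : qExpansion 1 E₄ = 1 + 240 * sigSer ℂ 3 := by
  ext m
  rw [E_qExpansion_coeff _ ⟨2, rfl⟩, show (240 : PowerSeries ℂ) = PowerSeries.C 240 from (map_ofNat PowerSeries.C 240).symm]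
  rcases eq_or_ne m 0 with rfl | hm
  · simp [sigSer]
  · norm_num [hm, sigSer, PowerSeries.coeff_one, show bernoulli 4 = -1 / 30 by decide +kernel]

open EisensteinSeries ModularForm UpperHalfPlane in
lemma e6_ser : qExpansion 1 E₆ = 1 - 504 * sigSer ℂ 5 := by
  ext m
  rw [E_qExpansion_coeff _ ⟨3, rfl⟩, show (504 : PowerSeries ℂ) = PowerSeries.C 504 from (map_ofNat PowerSeries.C 504).symm]
  rcases eq_or_ne m 0 with rfl | hm
  · simp [sigSer]
  · norm_num [hm, sigSer, PowerSeries.coeff_one, show bernoulli 6 = 1 / 42 by decide +kernel]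

lemma map_sigSer {R S : Type} [CommRing R] [CommRing S] (f : R →+* S) (k : ℕ) :
    PowerSeries.map f (sigSer R k) = sigSer S k := by
  ext; simp [sigSer]

lemma map_tauSer {R S : Type} [CommRing R] [CommRing S] (f : R →+* S) :
    PowerSeries.map f (tauSer R) = tauSer S := by
  ext; simp [tauSer]

lemma id_int : 1728 * tauSer ℤ = (1 + 240 * sigSer ℤ 3) ^ 3 - (1 - 504 * sigSer ℤ 5) ^ 2 := by
  have h := delta_id
  rw [e4_ser, e6_ser] at h
  have h2 : UpperHalfPlane.qExpansion 1 ModularForm.discriminant = tauSer ℂ := by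
    ext m; rw [qExpansion_delta]; simp [tauSer]
  rw [h2, ← map_tauSer (Int.castRingHom ℂ), ← map_sigSer (Int.castRingHom ℂ),
    ← map_sigSer (Int.castRingHom ℂ)] at h
  apply PowerSeries.map_injective (Int.castRingHom ℂ) Int.cast_injective
  rw [PowerSeries.smul_eq_C_mul, map_ofNat] at h
  simp only [map_mul, map_sub, map_add, map_pow, map_one, map_ofNat]
  exact h

lemma sig5 : sigSer (ZMod 5) 5 = sigSer (ZMod 5) 1 := by
  ext n
  simp only [sigSer, PowerSeries.coeff_mk, ArithmeticFunction.sigma_apply]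
  push_cast
  refine Finset.sum_congr rfl fun d _ => ?_
  generalize (d : ZMod 5) = x
  revert x; decide

lemma id_mod5 : 3 * tauSer (ZMod 5) = 1 - (1 + sigSer (ZMod 5) 1) ^ 2 := by
  have h := congrArg (PowerSeries.map (Int.castRingHom (ZMod 5))) id_int
  simp only [map_mul, map_sub, map_add, map_pow, map_one, map_ofNat, map_tauSer, map_sigSer,
    sig5] at h
  have h5 : (5 : PowerSeries (ZMod 5)) = 0 := by
    have : (5 : PowerSeries (ZMod 5)) = PowerSeries.C (5 : ZMod 5) := (map_ofNat PowerSeries.C 5).symm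
    rw [this, show (5 : ZMod 5) = 0 from rfl, map_zero]
  generalize tauSer (ZMod 5) = t at *
  generalize sigSer (ZMod 5) 1 = a at *
  generalize sigSer (ZMod 5) 3 = b at *
  have h' : 3 * t = ((1 + 5 * (48 * b)) ^ 3 - (1 + a - 5 * (101 * a)) ^ 2) - 5 * (345 * t) := by
    linear_combination h
  rw [h', h5]; ring

noncomputable def gSer (k : ℕ) : PowerSeries ℤ :=
  PowerSeries.mk fun n => if k ∣ n ∧ n ≠ 0 then 1 else 0

lemma gSer_spec {k : ℕ} (hk : k ≠ 0) :
    (1 - PowerSeries.X ^ k) * gSer k = PowerSeries.X ^ k := by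
  ext n
  rw [sub_mul, one_mul, map_sub, PowerSeries.coeff_X_pow_mul', PowerSeries.coeff_X_pow]
  simp only [gSer, PowerSeries.coeff_mk]
  rcases lt_trichotomy n k with h | h | h
  · have h1 : ¬ (k ∣ n ∧ n ≠ 0) := by
      rintro ⟨h1, h2⟩
      have := Nat.le_of_dvd (by omega) h1
      omega
    rw [if_neg h1, if_neg (not_le.mpr h), if_neg h.ne]
    simp
  · subst h; simp [hk]
  · obtain ⟨m, rfl⟩ := Nat.exists_eq_add_of_lt h
    have h1 : k + m + 1 - k = m + 1 := by omega
    have h2 : k ∣ k + m + 1 ↔ k ∣ m + 1 := by rw [add_assoc]; exact Nat.dvd_add_right (dvd_refl k)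
    rw [if_pos h.le, if_neg h.ne', h1]
    simp [h2]

noncomputable def lSer (N : ℕ) : PowerSeries ℤ :=
  ∑ k ∈ Finset.Icc 1 N, (k : PowerSeries ℤ) * gSer k

lemma lSer_coeff {n N : ℕ} (h : n ≤ N) :
    (lSer N).coeff n = (ArithmeticFunction.sigma 1 n : ℕ) := by
  simp only [lSer, map_sum]
  have h1 : ∀ k : ℕ, PowerSeries.coeff n ((k : PowerSeries ℤ) * gSer k)
      = if k ∣ n ∧ n ≠ 0 then (k : ℤ) else 0 := by
    intro k
    rw [← map_natCast (PowerSeries.C (R := ℤ)), PowerSeries.coeff_C_mul]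
    simp [gSer]
  simp_rw [h1]
  rw [← Finset.sum_filter, ArithmeticFunction.sigma_one_apply]
  push_cast
  refine Finset.sum_congr ?_ fun _ _ => rfl
  ext k
  simp only [Finset.mem_filter, Finset.mem_Icc, Nat.mem_divisors]
  constructor
  · tauto
  · rintro ⟨h1, h2⟩
    have := Nat.le_of_dvd (by omega) h1
    have := Nat.pos_of_dvd_of_pos h1 (by omega)
    exact ⟨⟨by omega, by omega⟩, h1, h2⟩

lemma theta_tauPoly (N : ℕ) :
    PowerSeries.X * PowerSeries.derivative ℤ (tauPoly N : PowerSeries ℤ)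
      = (tauPoly N : PowerSeries ℤ) * (1 - 24 * lSer N) := by
  induction N with
  | zero => simp [tauPoly, lSer]
  | succ N ih =>
    have h1 := gSer_spec (Nat.succ_ne_zero N)
    have h2 : lSer (N + 1) = lSer N + ((N + 1 : ℕ) : PowerSeries ℤ) * gSer (N + 1) := by
      simp [lSer, Finset.sum_Icc_succ_top]
    rw [tauPoly_succ, h2]
    have hW : PowerSeries.X * PowerSeries.derivative ℤ (1 - PowerSeries.X ^ (N + 1) : PowerSeries ℤ)
        = - (((N + 1 : ℕ) : PowerSeries ℤ) * PowerSeries.X ^ (N + 1)) := by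
      rw [map_sub, Derivation.leibniz_pow, Derivation.map_one_eq_zero, PowerSeries.derivative_X,
        Nat.add_sub_cancel, smul_eq_mul, nsmul_eq_mul]
      ring
    simp only [Polynomial.coe_mul, Polynomial.coe_pow, Polynomial.coe_sub, Polynomial.coe_one,
      Polynomial.coe_X]
    have hW : PowerSeries.X * PowerSeries.derivative ℤ (1 - PowerSeries.X ^ (N + 1) : PowerSeries ℤ)
        = - (((N + 1 : ℕ) : PowerSeries ℤ) * ((1 - PowerSeries.X ^ (N + 1)) * gSer (N + 1))) := by
      rw [hW]; congr 2; exact h1.symm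
    generalize (1 - PowerSeries.X ^ (N + 1) : PowerSeries ℤ) = W at *
    simp only [Derivation.leibniz, Derivation.leibniz_pow, smul_eq_mul, nsmul_eq_mul]
    generalize (tauPoly N : PowerSeries ℤ) = Y at *
    generalize PowerSeries.derivative ℤ Y = Y' at *
    generalize PowerSeries.derivative ℤ W = W' at *
    generalize gSer (N + 1) = G at *
    generalize ((N + 1 : ℕ) : PowerSeries ℤ) = c at *
    rw [show 24 - 1 = 23 from rfl]
    push_cast
    linear_combination W ^ 24 * ih + 24 * Y * W ^ 23 * hW

lemma theta_tauSer :
    PowerSeries.X * PowerSeries.derivative ℤ (tauSer ℤ)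
      = tauSer ℤ * (1 - 24 * sigSer ℤ 1) := by
  ext n
  have h := congrArg (PowerSeries.coeff n) (theta_tauPoly n)
  have h1 : ∀ m ≤ n, (tauPoly n : PowerSeries ℤ).coeff m = (tauSer ℤ).coeff m := by
    intro m hm
    simp [tauSer, tauPoly_coeff hm]
  have h24 : (24 : PowerSeries ℤ) = PowerSeries.C 24 := (map_ofNat PowerSeries.C 24).symm
  have h2 : ∀ m ≤ n, (1 - 24 * lSer n).coeff m = (1 - 24 * sigSer ℤ 1).coeff m := by
    intro m hm
    rw [h24, map_sub, map_sub, PowerSeries.coeff_C_mul, PowerSeries.coeff_C_mul, lSer_coeff hm]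
    simp [sigSer]
  have h3 : (tauSer ℤ * (1 - 24 * sigSer ℤ 1)).coeff n
      = ((tauPoly n : PowerSeries ℤ) * (1 - 24 * lSer n)).coeff n := by
    rw [PowerSeries.coeff_mul, PowerSeries.coeff_mul]
    refine Finset.sum_congr rfl fun p hp => ?_
    rw [Finset.HasAntidiagonal.mem_antidiagonal] at hp
    rw [h1 _ (by omega), h2 _ (by omega)]
  rw [h3, ← h]
  cases n with
  | zero => simp
  | succ n =>
    rw [PowerSeries.coeff_succ_X_mul, PowerSeries.coeff_succ_X_mul, PowerSeries.coeff_derivative,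
      PowerSeries.coeff_derivative, h1 _ le_rfl]

lemma tau_mod5_ser : tauSer (ZMod 5)
    = PowerSeries.X * PowerSeries.derivative (ZMod 5) (sigSer (ZMod 5) 1) := by
  have h5 : (5 : PowerSeries (ZMod 5)) = 0 := by
    have : (5 : PowerSeries (ZMod 5)) = PowerSeries.C (5 : ZMod 5) := (map_ofNat PowerSeries.C 5).symm
    rw [this, show (5 : ZMod 5) = 0 from rfl, map_zero]
  have h1 : PowerSeries.X * PowerSeries.derivative (ZMod 5) (tauSer (ZMod 5))
      = tauSer (ZMod 5) * (1 - 24 * sigSer (ZMod 5) 1) := by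
    have h := congrArg (PowerSeries.map (Int.castRingHom (ZMod 5))) theta_tauSer
    simp only [map_mul, map_sub, map_one, map_ofNat, map_tauSer, map_sigSer, PowerSeries.map_X] at h
    rw [← h]
    congr 1
    ext n
    simp [PowerSeries.coeff_derivative, tauSer]
  have h2 := congrArg (fun y => PowerSeries.X * PowerSeries.derivative (ZMod 5) y) id_mod5
  have h30 : PowerSeries.derivative (ZMod 5) (3 : PowerSeries (ZMod 5)) = 0 := by
    exact_mod_cast Derivation.map_natCast _ 3
  simp only [Derivation.leibniz, Derivation.leibniz_pow, map_sub, map_add, smul_eq_mul,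
      nsmul_eq_mul, Derivation.map_one_eq_zero, h30] at h2
  have h4 : (1 + sigSer (ZMod 5) 1) * (tauSer (ZMod 5)
    - PowerSeries.X * PowerSeries.derivative (ZMod 5) (sigSer (ZMod 5) 1)) = 0 := by
    generalize tauSer (ZMod 5) = t at *
    generalize sigSer (ZMod 5) 1 = a at *
    generalize PowerSeries.derivative (ZMod 5) t = t' at *
    generalize PowerSeries.derivative (ZMod 5) a = a' at *
    push_cast at h2
    linear_combination 2 * h2 - 6 * h1 + (-((1 + a) * (t - PowerSeries.X * a'))
      - 2 * (1 + a) * PowerSeries.X * a' + 30 * t * a) * h5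
  have h5 : (1 + sigSer (ZMod 5) 1) ≠ 0 := by
    intro h
    have := congrArg (PowerSeries.coeff 0) h
    simp [sigSer] at this
    exact absurd this (by decide)
  have : Fact (Nat.Prime 5) := ⟨by norm_num⟩
  have := (mul_eq_zero.mp h4).resolve_left h5
  exact sub_eq_zero.mp this

lemma tau_mod5 (n : ℕ) : (ramanujanTau n : ZMod 5)
    = (n : ZMod 5) * ((ArithmeticFunction.sigma 1 n : ℕ) : ZMod 5) := by
  have h := congrArg (PowerSeries.coeff n) tau_mod5_ser
  cases n with
  | zero => simpa [tauSer] using h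
  | succ n =>
    rw [PowerSeries.coeff_succ_X_mul, PowerSeries.coeff_derivative] at h
    simp only [tauSer, sigSer, PowerSeries.coeff_mk] at h
    rw [h]; push_cast; ring

lemma dvd_tau_iff (n : ℕ) : (5 : ℤ) ∣ ramanujanTau n ↔
    (5 ∣ n ∨ 5 ∣ ArithmeticFunction.sigma 1 n) := by
  have h1 := ZMod.intCast_zmod_eq_zero_iff_dvd (ramanujanTau n) 5
  have : Fact (Nat.Prime 5) := ⟨by norm_num⟩
  rw [tau_mod5, mul_eq_zero, ZMod.natCast_eq_zero_iff, ZMod.natCast_eq_zero_iff] at h1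
  exact_mod_cast h1.symm

lemma local_sum (m : ℕ) (hm : 2 ≤ m) (x : ℝ) (h0 : 0 < x) (h1 : x < 1) :
    HasSum (fun e : ℕ => if m ∣ e + 1 then 0 else x ^ e)
      ((1 - x ^ (m - 1)) / ((1 - x) * (1 - x ^ m))) := by
  have hg := hasSum_geometric_of_lt_one h0.le h1
  have hxm : x ^ m < 1 := pow_lt_one₀ h0.le h1 (by omega)
  have hg2 := (hasSum_geometric_of_lt_one (pow_nonneg h0.le m) hxm).mul_left (x ^ (m - 1))
  have hi : Function.Injective (fun j : ℕ => m * j + (m - 1)) := by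
    intro a b hab
    have : m * a = m * b := by simpa using hab
    exact Nat.eq_of_mul_eq_mul_left (by omega) this
  have hg3 : HasSum (fun e : ℕ => if m ∣ e + 1 then x ^ e else 0)
      (x ^ (m - 1) * (1 - x ^ m)⁻¹) := by
    rw [← hi.hasSum_iff]
    · suffices hfe : ((fun e : ℕ => if m ∣ e + 1 then x ^ e else 0) ∘ fun j : ℕ => m * j + (m - 1))
          = fun i => x ^ (m - 1) * (x ^ m) ^ i by
        rw [hfe]; exact hg2
      funext j
      have : m * j + (m - 1) + 1 = m * (j + 1) := by rw [mul_add, mul_one]; omega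
      simp only [Function.comp_apply, this, dvd_mul_right, if_true]
      rw [pow_add, pow_mul]; ring
    · intro e he
      rw [if_neg]
      rintro ⟨c, hc⟩
      apply he
      cases c with
      | zero => omega
      | succ c => exact ⟨c, by simp only; rw [mul_add, mul_one] at hc; omega⟩
  have h := hg.sub hg3
  have hv : (1 - x)⁻¹ - x ^ (m - 1) * (1 - x ^ m)⁻¹
      = (1 - x ^ (m - 1)) / ((1 - x) * (1 - x ^ m)) := by
    have hx1 : 1 - x ≠ 0 := by linarith
    have hx2 : 1 - x ^ m ≠ 0 := by linarith
    have hx3 : x ^ m = x ^ (m - 1) * x := by rw [← pow_succ]; congr 1; omega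
    field_simp
    rw [hx3]; ring
  rw [hv] at h
  suffices hfe : (fun e : ℕ => if m ∣ e + 1 then 0 else x ^ e)
      = fun b => x ^ b - if m ∣ b + 1 then x ^ b else 0 by
    rw [hfe]; exact h
  funext e
  split_ifs <;> simp

lemma geom_zero (r : ZMod 5) (m : ℕ) (hm : 0 < m) (h0 : ∑ i ∈ Finset.range m, r ^ i = 0)
    (hlt : ∀ j < m, j ≠ 0 → ∑ i ∈ Finset.range j, r ^ i ≠ 0) (n : ℕ) :
    ∑ i ∈ Finset.range n, r ^ i = 0 ↔ m ∣ n := by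
  have : Fact (Nat.Prime 5) := ⟨by norm_num⟩
  induction n using Nat.strong_induction_on with
  | _ n ih =>
    rcases lt_or_ge n m with h | h
    · rcases eq_or_ne n 0 with rfl | hn
      · simp
      · simp only [hlt n h hn, false_iff]
        intro hd
        have := Nat.le_of_dvd (by omega) hd
        omega
    · obtain ⟨k, rfl⟩ := Nat.exists_eq_add_of_le h
      have ihk : ∑ i ∈ Finset.range k, r ^ i = 0 ↔ m ∣ k := ih k (by omega)
      rw [Finset.sum_range_add, h0, zero_add, Nat.dvd_add_right (dvd_refl m), ← ihk]
      simp_rw [pow_add]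
      rw [← Finset.mul_sum, mul_eq_zero_iff_left]
      intro hr
      have hr0 : r = 0 := pow_eq_zero_iff (by omega) |>.mp hr
      subst hr0
      rw [Finset.sum_eq_single 0] at h0
      · simp at h0
      · intro b _ hb; simp [hb]
      · intro h; simp at h; omega

lemma sigma_pp {p : ℕ} (hp : p.Prime) (e : ℕ) :
    5 ∣ ArithmeticFunction.sigma 1 (p ^ e) ↔ ∑ i ∈ Finset.range (e + 1), (p : ZMod 5) ^ i = 0 := by
  rw [ArithmeticFunction.sigma_one_apply_prime_pow hp, ← ZMod.natCast_eq_zero_iff]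
  push_cast
  rfl

lemma cast_mod (p : ℕ) : (p : ZMod 5) = ((p % 5 : ℕ) : ZMod 5) := by simp

lemma sigma_pp_m {p : ℕ} (hp : p.Prime) (e m : ℕ)
    (h : (p % 5 = 1 ∧ m = 5) ∨ ((p % 5 = 2 ∨ p % 5 = 3) ∧ m = 4) ∨ (p % 5 = 4 ∧ m = 2)) :
    5 ∣ ArithmeticFunction.sigma 1 (p ^ e) ↔ m ∣ e + 1 := by
  rw [sigma_pp hp, cast_mod]
  rcases h with ⟨h, rfl⟩ | ⟨h | h, rfl⟩ | ⟨h, rfl⟩ <;> rw [h] <;>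
    exact geom_zero _ _ (by norm_num) (by decide) (by decide) _

noncomputable def fT (s : ℝ) (n : ℕ) : ℝ :=
  if 5 ∣ n ∨ 5 ∣ ArithmeticFunction.sigma 1 n then 0 else (n : ℝ) ^ (-s)

lemma fT_one (s : ℝ) : fT s 1 = 1 := by simp [fT]

lemma fT_zero (s : ℝ) : fT s 0 = 0 := by simp [fT]

lemma fT_mul (s : ℝ) {m n : ℕ} (h : m.Coprime n) : fT s (m * n) = fT s m * fT s n := by
  have h5 : Nat.Prime 5 := by norm_num
  have h1 := ArithmeticFunction.isMultiplicative_sigma (k := 1) |>.map_mul_of_coprime h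
  unfold fT
  simp only [h1, h5.dvd_mul]
  push_cast
  rw [Real.mul_rpow (Nat.cast_nonneg _) (Nat.cast_nonneg _)]
  by_cases a : 5 ∣ m <;> by_cases b : 5 ∣ n <;>
  by_cases c : 5 ∣ ArithmeticFunction.sigma 1 m <;> by_cases d : 5 ∣ ArithmeticFunction.sigma 1 n <;>
  simp [a, b, c, d]

lemma fT_nonneg (s : ℝ) (n : ℕ) : 0 ≤ fT s n := by
  unfold fT; split_ifs <;> positivity

lemma fT_le (s : ℝ) (n : ℕ) : fT s n ≤ (n : ℝ) ^ (-s) := by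
  unfold fT; split_ifs
  · positivity
  · rfl

lemma fT_summable {s : ℝ} (hs : 1 < s) : Summable (fT s) :=
  Summable.of_nonneg_of_le (fT_nonneg s) (fT_le s) (Real.summable_nat_rpow.mpr (by linarith))

lemma rpow_aux {p : ℕ} (k : ℕ) (s : ℝ) : ((p ^ k : ℕ) : ℝ) ^ (-s) = ((p : ℝ) ^ (-s)) ^ k := by
  push_cast
  rw [← Real.rpow_natCast, ← Real.rpow_natCast, ← Real.rpow_mul (Nat.cast_nonneg _),
    ← Real.rpow_mul (Nat.cast_nonneg _), mul_comm]

lemma rpow_aux2 {p : ℕ} (k s : ℝ) : (p : ℝ) ^ (-(k * s)) = ((p : ℝ) ^ (-s)) ^ k := by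
  rw [← Real.rpow_mul (Nat.cast_nonneg _)]; congr 1; ring

lemma x_bounds {p : ℕ} (hp : p.Prime) {s : ℝ} (hs : 1 < s) :
    0 < (p : ℝ) ^ (-s) ∧ (p : ℝ) ^ (-s) ≤ 1 / 2 := by
  have h2 : (2 : ℝ) ≤ p := by exact_mod_cast hp.two_le
  refine ⟨by positivity, ?_⟩
  calc (p : ℝ) ^ (-s) ≤ (p : ℝ) ^ (-1 : ℝ) :=
        Real.rpow_le_rpow_of_exponent_le (by linarith) (by linarith)
    _ = 1 / p := by rw [Real.rpow_neg_one, one_div]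
    _ ≤ 1 / 2 := one_div_le_one_div_of_le (by norm_num) h2

lemma local_factor {p : ℕ} (hp : p.Prime) {s : ℝ} (hs : 1 < s) (m : ℕ)
    (h : (p % 5 = 1 ∧ m = 5) ∨ ((p % 5 = 2 ∨ p % 5 = 3) ∧ m = 4) ∨ (p % 5 = 4 ∧ m = 2)) :
    ∑' e, fT s (p ^ e) = (1 - ((p : ℝ) ^ (-s)) ^ (m - 1)) /
      ((1 - (p : ℝ) ^ (-s)) * (1 - ((p : ℝ) ^ (-s)) ^ m)) := by
  obtain ⟨h0, h1⟩ := x_bounds hp hs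
  rw [← (local_sum m (by omega) _ h0 (by linarith)).tsum_eq]
  congr 1
  ext e
  have h5 : ¬ 5 ∣ p ^ e := by
    intro hd
    have := (show Nat.Prime 5 by norm_num).dvd_of_dvd_pow hd
    omega
  simp only [fT, h5, false_or, sigma_pp_m hp e m h, rpow_aux]

lemma local_factor_five (s : ℝ) : ∑' e, fT s (5 ^ e) = 1 := by
  rw [tsum_eq_single 0]
  · simp [fT_one]
  · intro e he
    simp [fT, dvd_pow_self 5 he]

lemma local_bound {p : ℕ} (hp : p.Prime) {s : ℝ} (hs : 1 < s) :
    0 ≤ (∑' e, fT s (p ^ e)) - 1 ∧ (∑' e, fT s (p ^ e)) - 1 ≤ 2 * (p : ℝ) ^ (-s) := by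
  obtain ⟨h0, h1⟩ := x_bounds hp hs
  have hg : Summable fun e : ℕ => ((p : ℝ) ^ (-s)) ^ e :=
    summable_geometric_of_lt_one h0.le (by linarith)
  have hS : Summable fun e => fT s (p ^ e) :=
    (fT_summable hs).comp_injective (Nat.pow_right_injective hp.two_le)
  rw [hS.tsum_eq_zero_add, pow_zero, fT_one, add_sub_cancel_left]
  refine ⟨tsum_nonneg fun _ => fT_nonneg _ _, ?_⟩
  have hS1 : Summable fun e => fT s (p ^ (e + 1)) :=
    (summable_nat_add_iff (f := fun e => fT s (p ^ e)) 1).mpr hS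
  have hle : ∑' e, fT s (p ^ (e + 1)) ≤ ∑' e, (p : ℝ) ^ (-s) * ((p : ℝ) ^ (-s)) ^ e := by
    refine Summable.tsum_le_tsum (fun e => ?_) hS1 (hg.mul_left _)
    refine (fT_le _ _).trans ?_
    rw [rpow_aux, pow_succ']
  refine hle.trans ?_
  rw [tsum_mul_left, tsum_geometric_of_lt_one h0.le (by linarith), mul_comm]
  refine mul_le_mul_of_nonneg_right ?_ h0.le
  rw [inv_le_comm₀ (by linarith) (by norm_num)]
  linarith

lemma mult_class {s : ℝ} (hs : 1 < s) (S : Set ℕ) (hS : ∀ p ∈ S, p.Prime) :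
    Multipliable (S.mulIndicator fun p => ∑' e, fT s (p ^ e)) := by
  have h : Summable (fun p => (S.mulIndicator fun p => ∑' e, fT s (p ^ e)) p - 1) := by
    refine Summable.of_nonneg_of_le (f := fun p : ℕ => 2 * (p : ℝ) ^ (-s)) ?_ ?_
      ((Real.summable_nat_rpow.mpr (by linarith)).mul_left 2)
    · intro p
      by_cases hp : p ∈ S
      · simp only [Set.mulIndicator_of_mem hp]; exact (local_bound (hS p hp) hs).1
      · simp [hp]
    · intro p
      by_cases hp : p ∈ S
      · simp only [Set.mulIndicator_of_mem hp]; exact (local_bound (hS p hp) hs).2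
      · simp only [Set.mulIndicator_of_notMem hp]; simp only [sub_self]; positivity
  have := Real.multipliable_one_add_of_summable h
  simpa using this

/-- The Euler product for `T(s) = ∑_{n≥1} t_n n^{-s}` in the `5 ∤ τ(n)` case. -/
theorem euler_product_T_five (s : ℝ) (hs : 1 < s) :
    (∑' n : ℕ, t5 (n + 1) / ((n : ℝ) + 1) ^ s)
      = (∏' p : {p : ℕ // p.Prime ∧ p % 5 = 1},
            (1 - (p.1 : ℝ) ^ (-(4 * s)))
              / ((1 - (p.1 : ℝ) ^ (-s)) * (1 - (p.1 : ℝ) ^ (-(5 * s)))))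
        * (∏' p : {p : ℕ // p.Prime ∧ (p % 5 = 2 ∨ p % 5 = 3)},
            (1 - (p.1 : ℝ) ^ (-(3 * s)))
              / ((1 - (p.1 : ℝ) ^ (-s)) * (1 - (p.1 : ℝ) ^ (-(4 * s)))))
        * (∏' p : {p : ℕ // p.Prime ∧ p % 5 = 4},
            (1 - (p.1 : ℝ) ^ (-(2 * s)))⁻¹) := by
  have hL : (∑' n : ℕ, t5 (n + 1) / ((n : ℝ) + 1) ^ s) = ∑' n, fT s n := by
    rw [(fT_summable hs).tsum_eq_zero_add, fT_zero, zero_add]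
    refine tsum_congr fun n => ?_
    simp only [t5, fT, dvd_tau_iff]
    split_ifs
    · simp
    · push_cast
      rw [Real.rpow_neg (by positivity), one_div]
  have hE := (EulerProduct.eulerProduct_hasProd_mulIndicator (fT_one s) (fun h => fT_mul s h)
    (by simpa [abs_of_nonneg (fT_nonneg s _)] using fT_summable hs) (fT_zero s)).tprod_eq
  set F : ℕ → ℝ := fun p => ∑' e, fT s (p ^ e) with hF
  let S₁ : Set ℕ := {p | p.Prime ∧ p % 5 = 1}
  let S₂ : Set ℕ := {p | p.Prime ∧ (p % 5 = 2 ∨ p % 5 = 3)}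
  let S₃ : Set ℕ := {p | p.Prime ∧ p % 5 = 4}
  have m₁ := mult_class hs S₁ (fun p hp => hp.1)
  have m₂ := mult_class hs S₂ (fun p hp => hp.1)
  have m₃ := mult_class hs S₃ (fun p hp => hp.1)
  have hsplit : Set.mulIndicator {p | Nat.Prime p} F
      = fun p => S₁.mulIndicator F p * S₂.mulIndicator F p * S₃.mulIndicator F p := by
    ext p
    by_cases hp : p.Prime
    · rw [Set.mulIndicator_of_mem (show p ∈ {p | Nat.Prime p} from hp)]
      have hlt : p % 5 < 5 := Nat.mod_lt _ (by norm_num)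
      have hc : p % 5 = 0 ∨ p % 5 = 1 ∨ (p % 5 = 2 ∨ p % 5 = 3) ∨ p % 5 = 4 := by omega
      rcases hc with h | h | h | h
      · have h5 : p = 5 := ((Nat.prime_dvd_prime_iff_eq (by norm_num) hp).mp
          (Nat.dvd_of_mod_eq_zero h)).symm
        simp [Set.mulIndicator, S₁, S₂, S₃, h, hF, h5, local_factor_five]
      · simp [Set.mulIndicator, S₁, S₂, S₃, h, hp]
      · have : p % 5 ≠ 1 ∧ p % 5 ≠ 4 := by omega
        simp [Set.mulIndicator, S₁, S₂, S₃, h, hp, this]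
      · simp [Set.mulIndicator, S₁, S₂, S₃, h, hp]
    · simp [Set.mulIndicator, S₁, S₂, S₃, hp]
  rw [hL, ← hE, hsplit, (m₁.mul m₂).tprod_mul m₃, m₁.tprod_mul m₂, ← _root_.tprod_subtype S₁,
    ← _root_.tprod_subtype S₂, ← _root_.tprod_subtype S₃]
  have r4 : ∀ p : ℕ, (p : ℝ) ^ (-(4 * s)) = ((p : ℝ) ^ (-s)) ^ 4 := fun p => by
    rw [rpow_aux2]; exact_mod_cast Real.rpow_natCast _ 4
  have r5 : ∀ p : ℕ, (p : ℝ) ^ (-(5 * s)) = ((p : ℝ) ^ (-s)) ^ 5 := fun p => by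
    rw [rpow_aux2]; exact_mod_cast Real.rpow_natCast _ 5
  have r3 : ∀ p : ℕ, (p : ℝ) ^ (-(3 * s)) = ((p : ℝ) ^ (-s)) ^ 3 := fun p => by
    rw [rpow_aux2]; exact_mod_cast Real.rpow_natCast _ 3
  have r2 : ∀ p : ℕ, (p : ℝ) ^ (-(2 * s)) = ((p : ℝ) ^ (-s)) ^ 2 := fun p => by
    rw [rpow_aux2]; exact_mod_cast Real.rpow_natCast _ 2
  congr 1
  · congr 1
    · refine tprod_congr fun p => ?_
      rw [r4, r5]
      exact local_factor p.2.1 hs 5 (Or.inl ⟨p.2.2, rfl⟩)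
    · refine tprod_congr fun p => ?_
      rw [r3, r4]
      exact local_factor p.2.1 hs 4 (Or.inr (Or.inl ⟨p.2.2, rfl⟩))
  · refine tprod_congr fun p => ?_
    rw [r2]
    rw [local_factor p.2.1 hs 2 (Or.inr (Or.inr ⟨p.2.2, rfl⟩))]
    obtain ⟨h0, h1⟩ := x_bounds p.2.1 hs
    have : 1 - (p.1 : ℝ) ^ (-s) ≠ 0 := by linarith
    rw [show 2 - 1 = 1 from rfl, pow_one, div_mul_eq_div_div, div_self this, one_div]
end
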